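/- arXiv:1504.05121 — 2 statements merged into one kernel-verified Lean document; each statement's English description precedes it below -/
import Mathlib

section
/- Let (X, μ, T) be a probability space with a measurable map T, and suppose there is a constant D such that μ(T^{-n}E) ≤ D·μ(E) for all measurable E and all n ≥ n₀. Then the Cesàro averages ρ_n(A) = (1/n)·Σ_{k=0}^{n-1} μ(T^{-k}A) have a limit ρ(A) for every measurable A, ρ is a probability measure on X, ρ is T-invariant, and (1/D)·μ(E) ≤ ρ(E) ≤ D·μ(E) for all measurable E (so ρ and μ are mutually absolutely continuous). -/
open MeasureTheory Filter

open scoped ENNReal Topology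

/-- A sequence of measures dominated by a finite measure has a setwise limit along every
ultrafilter, and this limit is a measure. -/
theorem exists_measure_tendsto_ultrafilter {X ι : Type*} [MeasurableSpace X]
    {μ : Measure X} [IsFiniteMeasure μ] {c : ℝ≥0∞} (hc : c ≠ ∞) {ρ : ι → Measure X}
    (hρ : ∀ i, ρ i ≤ c • μ) (U : Ultrafilter ι) :
    ∃ ν : Measure X, ∀ A, MeasurableSet A → Tendsto (fun i => ρ i A) U (𝓝 (ν A)) := by
  have hle : ∀ i A, ρ i A ≤ c * μ A := fun i A => hρ i A
  have hfin : ∀ A, c * μ A ≠ ∞ := fun A => ENNReal.mul_ne_top hc (measure_ne_top μ A)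
  have hlim : ∀ A : Set X, ∃ l, Tendsto (fun i => ρ i A) U (𝓝 l) := fun A =>
    ⟨_, (U.map fun i => ρ i A).le_nhds_lim⟩
  choose m hm using hlim
  have hmle : ∀ A, m A ≤ c * μ A := fun A =>
    le_of_tendsto (hm A) (Eventually.of_forall fun i => hle i A)
  have hmfin : ∀ A, m A ≠ ∞ := fun A => ne_top_of_le_ne_top (hfin A) (hmle A)
  have hm_empty : m ∅ = 0 := by simpa using hmle ∅
  have hm_union : ∀ ⦃f : ℕ → Set X⦄, (∀ i, MeasurableSet (f i)) →
      Pairwise (Function.onFun Disjoint f) → m (⋃ i, f i) = ∑' i, m (f i) := by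
    intro f hf hd
    have hsum : ∑' k, c * μ (f k) ≠ ∞ := by
      rw [ENNReal.tsum_mul_left, ← measure_iUnion hd hf]
      exact hfin _
    have hmsum : ∑' k, m (f k) ≠ ∞ :=
      ne_top_of_le_ne_top hsum (ENNReal.tsum_le_tsum fun k => hmle _)
    have key := tendsto_tsum_of_dominated_convergence (𝓕 := (U : Filter ι))
      (f := fun i k => (ρ i (f k)).toReal) (g := fun k => (m (f k)).toReal)
      (bound := fun k => (c * μ (f k)).toReal) (ENNReal.summable_toReal hsum)
      (fun k => (ENNReal.tendsto_toReal (hmfin _)).comp (hm _))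
      (Eventually.of_forall fun i k => by
        rw [Real.norm_of_nonneg ENNReal.toReal_nonneg]
        exact ENNReal.toReal_mono (hfin _) (hle i _))
    have hρsum : ∀ i, ∑' k, (ρ i (f k)).toReal = (ρ i (⋃ k, f k)).toReal := fun i => by
      rw [measure_iUnion hd hf, ENNReal.tsum_toReal_eq]
      exact fun k => ne_top_of_le_ne_top (hfin _) (hle i _)
    simp only [hρsum, ← ENNReal.tsum_toReal_eq fun k => hmfin (f k)] at key
    exact (ENNReal.toReal_eq_toReal_iff' (hmfin _) hmsum).1 <|
      tendsto_nhds_unique ((ENNReal.tendsto_toReal (hmfin _)).comp (hm _)) key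
  refine ⟨Measure.ofMeasurable (fun A _ => m A) hm_empty fun f hf hd => hm_union hf hd,
    fun A hA => ?_⟩
  rw [Measure.ofMeasurable_apply A hA]
  exact hm A

/-- If `T` preserves a finite measure `ν` dominating `μ`, then the Cesàro averages of
`μ (T^[k] ⁻¹' A)` converge, by the mean ergodic theorem in `L²(ν)`. -/
theorem exists_tendsto_cesaro_of_measurePreserving {X : Type*} [MeasurableSpace X]
    {μ ν : Measure X} [IsFiniteMeasure μ] [IsFiniteMeasure ν] {T : X → X}
    (hT : MeasurePreserving T ν ν) {c : ℝ≥0∞} (hc : c ≠ ∞) (hμν : μ ≤ c • ν)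
    {A : Set X} (hA : MeasurableSet A) :
    ∃ l : ℝ≥0∞, Tendsto (fun n : ℕ => (n : ℝ≥0∞)⁻¹ * ∑ k ∈ Finset.range n, μ (T^[k] ⁻¹' A))
      atTop (𝓝 l) := by
  let U : Lp ℝ 2 ν →L[ℝ] Lp ℝ 2 ν :=
    (Lp.compMeasurePreservingₗᵢ ℝ T hT).toContinuousLinearMap
  have hU : ‖U‖ ≤ 1 := LinearIsometry.norm_toContinuousLinearMap_le _
  let ind : ∀ B : Set X, MeasurableSet B → Lp ℝ 2 ν := fun B hB =>
    indicatorConstLp 2 hB (measure_ne_top ν B) 1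
  let L : Lp ℝ 2 ν →L[ℝ] ℝ :=
    (innerSL ℝ (indicatorConstLp 2 MeasurableSet.univ (measure_ne_top μ Set.univ) (1 : ℝ))).comp
      (Lp.LpToLpOfMeasureLeSMul hc hμν)
  have hL : ∀ B (hB : MeasurableSet B), L (ind B hB) = μ.real B := by
    intro B hB
    have hae : (Lp.LpToLpOfMeasureLeSMul hc hμν (ind B hB) : X → ℝ) =ᵐ[μ]
        B.indicator fun _ => 1 :=
      (Lp.coeFn_LpToLpOfMeasureLeSMul hc hμν _).trans
        ((Measure.absolutelyContinuous_of_le_smul hμν).ae_eq indicatorConstLp_coeFn)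
    simp only [L, ContinuousLinearMap.comp_apply, innerSL_apply_apply]
    rw [L2.inner_indicatorConstLp_one, setIntegral_univ, integral_congr_ae hae,
      integral_indicator_const _ hB]
    simp
  have hiter : ∀ k, U^[k] (ind A hA) = ind (T^[k] ⁻¹' A) (hT.measurable.iterate k hA) := by
    intro k
    induction k with
    | zero => rfl
    | succ k ih =>
      rw [Function.iterate_succ_apply', ih]
      exact Lp.indicatorConstLp_compMeasurePreserving _ _ _ hT
  have hlim := (L.continuous.tendsto _).comp
    (U.tendsto_birkhoffAverage_orthogonalProjection hU (ind A hA))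
  refine ⟨_, (ENNReal.tendsto_ofReal hlim).congr' ?_⟩
  filter_upwards [eventually_gt_atTop 0] with n hn
  have hn' : (0 : ℝ) < n := by exact_mod_cast hn
  simp only [Function.comp_apply, birkhoffAverage, birkhoffSum, map_smul, map_sum, id, hiter, hL,
    smul_eq_mul]
  rw [ENNReal.ofReal_mul (by positivity), ENNReal.ofReal_inv_of_pos hn', ENNReal.ofReal_natCast,
    ENNReal.ofReal_sum_of_nonneg fun _ _ => measureReal_nonneg]
  simp

/-- Existence of an absolutely continuous invariant measure from Cesàro averages:
if `μ(T^{-n}E)` is comparable to `μ(E)` (constant `D`, for `n ≥ n₀`), then the Cesàro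
averages `ρ_n(A) = (1/n)Σ_{k<n} μ(T^{-k}A)` converge to a `T`-invariant probability
measure `ρ` with `(1/D)·μ(E) ≤ ρ(E) ≤ D·μ(E)` for all measurable `E`. -/
theorem cesaro_invariant_measure {X : Type*} [MeasurableSpace X]
    (μ : Measure X) [IsProbabilityMeasure μ] (T : X → X) (hT : Measurable T)
    (D : ℝ) (hD : 1 ≤ D) (n₀ : ℕ)
    (hbound : ∀ (E : Set X), MeasurableSet E → ∀ n, n₀ ≤ n →
      ENNReal.ofReal (1 / D) * μ E ≤ μ ((T^[n]) ⁻¹' E) ∧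
      μ ((T^[n]) ⁻¹' E) ≤ ENNReal.ofReal D * μ E) :
    ∃ ρ : Measure X, IsProbabilityMeasure ρ ∧
      (∀ A : Set X, MeasurableSet A →
        Tendsto (fun n : ℕ => (n : ENNReal)⁻¹ * ∑ k ∈ Finset.range n, μ ((T^[k]) ⁻¹' A))
          atTop (nhds (ρ A))) ∧
      (∀ E : Set X, MeasurableSet E → ρ (T ⁻¹' E) = ρ E) ∧
      (∀ E : Set X, MeasurableSet E →
        ENNReal.ofReal (1 / D) * μ E ≤ ρ E ∧ ρ E ≤ ENNReal.ofReal D * μ E) := by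
  set c := ENNReal.ofReal D with hc_def
  set d := ENNReal.ofReal (1 / D) with hd_def
  have hD0 : 0 < D := by linarith
  have hc : c ≠ ∞ := ENNReal.ofReal_ne_top
  have hcd : c * d = 1 := by
    rw [hc_def, hd_def, ← ENNReal.ofReal_mul hD0.le, mul_one_div_cancel hD0.ne',
      ENNReal.ofReal_one]
  have hpre : ∀ k j (A : Set X), T^[k] ⁻¹' (T^[j] ⁻¹' A) = T^[j + k] ⁻¹' A := fun k j A => by
    rw [Function.iterate_add, Set.preimage_comp]
  have hbd : ∀ k (A : Set X), MeasurableSet A → μ (T^[k] ⁻¹' A) ≤ c * c * μ A := by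
    intro k A hA
    calc μ (T^[k] ⁻¹' A) = c * (d * μ (T^[k] ⁻¹' A)) := by rw [← mul_assoc, hcd, one_mul]
      _ ≤ c * μ (T^[n₀] ⁻¹' (T^[k] ⁻¹' A)) := by
        gcongr
        exact (hbound _ (hT.iterate k hA) n₀ le_rfl).1
      _ ≤ c * (c * μ A) := by
        rw [hpre]
        gcongr
        exact (hbound A hA _ (Nat.le_add_left _ _)).2
      _ = c * c * μ A := (mul_assoc _ _ _).symm
  let avg : ℕ → Set X → ℝ≥0∞ := fun n A => (n : ℝ≥0∞)⁻¹ * ∑ k ∈ Finset.range n, μ (T^[k] ⁻¹' A)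
  have havg_le : ∀ n A (b : ℝ≥0∞), (∀ k, μ (T^[k] ⁻¹' A) ≤ b) → avg n A ≤ b := by
    intro n A b hb
    calc avg n A ≤ (n : ℝ≥0∞)⁻¹ * ∑ k ∈ Finset.range n, b := by
          simp only [avg]
          gcongr
          exact hb _
      _ = ((n : ℝ≥0∞)⁻¹ * n) * b := by simp [mul_assoc]
      _ ≤ b := mul_le_of_le_one_left (zero_le) (ENNReal.inv_mul_le_one _)
  have hle_avg : ∀ n A (b : ℝ≥0∞), 0 < n → (∀ k, b ≤ μ (T^[k] ⁻¹' A)) → b ≤ avg n A := by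
    intro n A b hn hb
    calc b = ((n : ℝ≥0∞)⁻¹ * n) * b := by
          rw [ENNReal.inv_mul_cancel (by simpa using hn.ne') (by simp), one_mul]
      _ = (n : ℝ≥0∞)⁻¹ * ∑ k ∈ Finset.range n, b := by simp [mul_assoc]
      _ ≤ avg n A := by
          simp only [avg]
          gcongr
          exact hb _
  let ρ : ℕ → Measure X := fun n => (n : ℝ≥0∞)⁻¹ • ∑ k ∈ Finset.range n, μ.map T^[k]
  have hρ : ∀ n A, MeasurableSet A → ρ n A = avg n A := by
    intro n A hA
    simp only [ρ, avg, Measure.smul_apply, Measure.finsetSum_apply, smul_eq_mul]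
    congr 1
    exact Finset.sum_congr rfl fun k _ => Measure.map_apply (hT.iterate k) hA
  have hρ_le : ∀ n, ρ n ≤ (c * c) • μ := fun n => Measure.le_iff.2 fun A hA => by
    rw [hρ n A hA]
    exact havg_le n A _ fun k => hbd k A hA
  let U : Ultrafilter ℕ := Ultrafilter.of atTop
  have hU : (U : Filter ℕ) ≤ atTop := Ultrafilter.of_le _
  have hU_pos : ∀ᶠ n in (U : Filter ℕ), 0 < n := hU (eventually_gt_atTop 0)
  obtain ⟨ν, hν⟩ := exists_measure_tendsto_ultrafilter (ENNReal.mul_ne_top hc hc) hρ_le U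
  have hν : ∀ A, MeasurableSet A → Tendsto (avg · A) U (𝓝 (ν A)) := fun A hA =>
    (hν A hA).congr fun n => hρ n A hA
  have hν_prob : IsProbabilityMeasure ν := ⟨le_antisymm
    (le_of_tendsto (hν _ .univ) (.of_forall fun n => havg_le _ _ _ fun k => by simp))
    (ge_of_tendsto (hν _ .univ) (hU_pos.mono fun n hn => hle_avg _ _ _ hn fun k => by simp))⟩
  have hinv : ∀ E, MeasurableSet E → ν (T ⁻¹' E) = ν E := by
    intro E hE
    have hsmall : ∀ a : ℕ → ℝ≥0∞, (∀ n, a n ≤ 1) →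
        Tendsto (fun n : ℕ => (n : ℝ≥0∞)⁻¹ * a n) U (𝓝 0) := fun a ha =>
      tendsto_of_tendsto_of_tendsto_of_le_of_le tendsto_const_nhds
        (ENNReal.tendsto_inv_nat_nhds_zero.mono_left hU) (fun n => zero_le)
        fun n => mul_le_of_le_one_right (zero_le) (ha n)
    have h1 := (hν _ (hT hE)).add (hsmall (fun _ => μ E) fun _ => prob_le_one)
    have h2 := (hν _ hE).add (hsmall (fun n => μ (T^[n] ⁻¹' E)) fun _ => prob_le_one)
    rw [add_zero] at h1 h2
    refine tendsto_nhds_unique (h1.congr fun n => ?_) h2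
    simp only [avg, ← mul_add]
    rw [← Finset.sum_range_succ, Finset.sum_range_succ']
    simp only [Function.iterate_succ', Set.preimage_comp, Function.iterate_zero, Set.preimage_id]
  have hT_ν : MeasurePreserving T ν ν :=
    ⟨hT, Measure.ext fun E hE => by rw [Measure.map_apply hT hE, hinv E hE]⟩
  have hν_bounds : ∀ E, MeasurableSet E → d * μ E ≤ ν E ∧ ν E ≤ c * μ E := by
    intro E hE
    have hE' := hT.iterate n₀ hE
    rw [← (hT_ν.iterate n₀).measure_preimage hE.nullMeasurableSet]
    refine ⟨ge_of_tendsto (hν _ hE') (hU_pos.mono fun n hn => hle_avg _ _ _ hn fun k => ?_),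
      le_of_tendsto (hν _ hE') (.of_forall fun n => havg_le _ _ _ fun k => ?_)⟩
    · rw [hpre]
      exact (hbound E hE _ (Nat.le_add_right _ _)).1
    · rw [hpre]
      exact (hbound E hE _ (Nat.le_add_right _ _)).2
  have hμν : μ ≤ c • ν := Measure.le_iff.2 fun E hE => by
    calc μ E = c * (d * μ E) := by rw [← mul_assoc, hcd, one_mul]
      _ ≤ c * ν E := by
        gcongr
        exact (hν_bounds E hE).1
  refine ⟨ν, hν_prob, fun A hA => ?_, hinv, hν_bounds⟩
  obtain ⟨l, hl⟩ := exists_tendsto_cesaro_of_measurePreserving hT_ν hc hμν hA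
  rwa [tendsto_nhds_unique (hν A hA) (hl.mono_left hU)]
end

section
/- Main theorem: Let M be a 2×2 matrix with integer coefficients and nonzero determinant, and let x ∈ ℝ be continued-fraction normal. Then Mx = (αx + β)/(γx + δ) is also continued-fraction normal. In particular, for any rational numbers q ≠ 0 and r, the number qx + r is continued-fraction normal whenever x is. -/
open MeasureTheory Filter

/-- The Gauss map `T(x) = 1/x - ⌊1/x⌋` (with `T 0 = 0`). -/
noncomputable def gauss (x : ℝ) : ℝ := if x = 0 then 0 else x⁻¹ - ⌊x⁻¹⌋

/-- `cfDigit x i` is the continued fraction partial quotient `a_{i+1}(x)`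
of `x ∈ [0,1)`, namely `⌊1 / T^i x⌋`. -/
noncomputable def cfDigit (x : ℝ) (i : ℕ) : ℤ := ⌊(gauss^[i] x)⁻¹⌋

/-- The continued fraction cylinder set of the string `s = [c₁,…,c_n]`. -/
def cyl (s : List ℤ) : Set ℝ :=
  {x | x ∈ Set.Ico (0 : ℝ) 1 ∧ ∀ i < s.length, cfDigit x i = s.getD i 0}

/-- The Gauss measure `μ(A) = ∫_A dx / ((log 2)(1+x))` on `[0,1)`. -/
noncomputable def gaussMeasure : Measure ℝ :=
  (volume.restrict (Set.Ico (0 : ℝ) 1)).withDensity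
    (fun x => ENNReal.ofReal (1 / (Real.log 2 * (1 + x))))

open scoped Classical in
/-- The number of `i < n` with `T^i x` in the cylinder of `s`. -/
noncomputable def cfCount (x : ℝ) (s : List ℤ) (n : ℕ) : ℕ :=
  ((Finset.range n).filter (fun i => gauss^[i] x ∈ cyl s)).card

/-- `x ∈ [0,1)` is CF-normal: every finite string of positive integers occurs in the
continued fraction expansion of `x` with limiting frequency equal to the Gauss
measure of its cylinder set. -/
noncomputable def cfNormal (x : ℝ) : Prop :=
  x ∈ Set.Ico (0 : ℝ) 1 ∧
  ∀ s : List ℤ, s ≠ [] → (∀ c ∈ s, 0 < c) →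
    Tendsto (fun n : ℕ => (cfCount x s n : ℝ) / n) atTop
      (nhds (gaussMeasure (cyl s)).toReal)

/-- A real number `y` is CF-normal if its fractional part is CF-normal. -/
noncomputable def cfNormalReal (y : ℝ) : Prop := cfNormal (Int.fract y)

/-- The action of an integer matrix on a real number by a linear fractional
transformation. -/
noncomputable def mobius (M : Matrix (Fin 2) (Fin 2) ℤ) (x : ℝ) : ℝ :=
  ((M 0 0 : ℝ) * x + (M 0 1 : ℝ)) / ((M 1 0 : ℝ) * x + (M 1 1 : ℝ))

open scoped ENNReal NNReal

theorem gauss_eq_fract (x : ℝ) : gauss x = Int.fract x⁻¹ := by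
  unfold gauss Int.fract
  split_ifs with h <;> simp [h]

theorem gauss_mem_Ico (x : ℝ) : gauss x ∈ Set.Ico (0 : ℝ) 1 := by
  rw [gauss_eq_fract]
  exact ⟨Int.fract_nonneg _, Int.fract_lt_one _⟩

theorem gauss_iterate_mem_Ico {x : ℝ} (hx : x ∈ Set.Ico (0 : ℝ) 1) (n : ℕ) :
    gauss^[n] x ∈ Set.Ico (0 : ℝ) 1 := by
  cases n with
  | zero => exact hx
  | succ n => rw [Function.iterate_succ_apply']; exact gauss_mem_Ico _

/-- The continued fraction expansion of `x ∈ (0,1)` does not terminate. -/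
def CFInfinite (x : ℝ) : Prop := ∀ n, gauss^[n] x ∈ Set.Ioo (0 : ℝ) 1

theorem inv_gauss_iterate (x : ℝ) (n : ℕ) :
    (gauss^[n] x)⁻¹ = cfDigit x n + gauss^[n + 1] x := by
  rw [Function.iterate_succ_apply', gauss_eq_fract, cfDigit, Int.floor_add_fract]

theorem irrational_gauss {x : ℝ} (hx : Irrational x) : Irrational (gauss x) := by
  rw [gauss_eq_fract, Int.fract]
  exact (irrational_inv_iff.mpr hx).sub_intCast _

theorem irrational_gauss_iterate {x : ℝ} (hx : Irrational x) (n : ℕ) :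
    Irrational (gauss^[n] x) := by
  induction n with
  | zero => exact hx
  | succ n ih => rw [Function.iterate_succ_apply']; exact irrational_gauss ih

theorem cfInfinite_of_irrational {x : ℝ} (hx : Irrational x) (h : x ∈ Set.Ico (0 : ℝ) 1) :
    CFInfinite x := fun n =>
  ⟨lt_of_le_of_ne (gauss_iterate_mem_Ico h n).1 (irrational_gauss_iterate hx n).ne_zero.symm,
    (gauss_iterate_mem_Ico h n).2⟩

theorem CFInfinite.one_le_cfDigit {x : ℝ} (hx : CFInfinite x) (n : ℕ) : 1 ≤ cfDigit x n := by
  rw [cfDigit, Int.le_floor]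
  have h := hx n
  push_cast
  exact (one_le_inv₀ h.1).mpr h.2.le

/-- The numerators `p_{n-1}` of the convergents of `x`, starting from `p_{-1} = 1`. -/
noncomputable def cfNum (x : ℝ) : ℕ → ℤ
  | 0 => 1
  | 1 => 0
  | n + 2 => cfDigit x n * cfNum x (n + 1) + cfNum x n

/-- The denominators `q_{n-1}` of the convergents of `x`, starting from `q_{-1} = 0`. -/
noncomputable def cfDen (x : ℝ) : ℕ → ℤ
  | 0 => 0
  | 1 => 1
  | n + 2 => cfDigit x n * cfDen x (n + 1) + cfDen x n

/-- The product `x · T x ⋯ T^{n-1} x`. -/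
noncomputable def gaussProd (x : ℝ) (n : ℕ) : ℝ := ∏ i ∈ Finset.range n, gauss^[i] x

theorem gaussProd_succ (x : ℝ) (n : ℕ) :
    gaussProd x (n + 1) = gaussProd x n * gauss^[n] x := Finset.prod_range_succ _ _

@[simp] theorem gaussProd_zero (x : ℝ) : gaussProd x 0 = 1 := Finset.prod_range_zero _

theorem cfNum_mul_cfDen_sub (x : ℝ) (n : ℕ) :
    cfNum x (n + 1) * cfDen x n - cfNum x n * cfDen x (n + 1) = (-1) ^ (n + 1) := by
  induction n with
  | zero => simp [cfNum, cfDen]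
  | succ n ih =>
    rw [cfNum, cfDen, pow_succ, ← ih]; ring

namespace CFInfinite

variable {x : ℝ} (hx : CFInfinite x)
include hx

theorem mul_inv_gauss (n : ℕ) :
    gauss^[n] x * (cfDigit x n + gauss^[n + 1] x) = 1 := by
  rw [← inv_gauss_iterate, mul_inv_cancel₀ (hx n).1.ne']

theorem gaussProd_pos (n : ℕ) : 0 < gaussProd x n :=
  Finset.prod_pos fun i _ => (hx i).1

theorem gaussProd_antitone : Antitone (gaussProd x) :=
  antitone_nat_of_succ_le fun n => by
    rw [gaussProd_succ]
    exact mul_le_of_le_one_right (hx.gaussProd_pos n).le (hx n).2.le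

theorem gaussProd_le_one (n : ℕ) : gaussProd x n ≤ 1 := by
  simpa using hx.gaussProd_antitone (Nat.zero_le n)

theorem gaussProd_add_two_le (n : ℕ) : gaussProd x (n + 2) ≤ gaussProd x n / 2 := by
  rw [gaussProd_succ, gaussProd_succ, mul_assoc, div_eq_mul_inv]
  refine mul_le_mul_of_nonneg_left ?_ (hx.gaussProd_pos n).le
  have h1 := hx.mul_inv_gauss n
  have h2 : (1 : ℝ) ≤ cfDigit x n := by exact_mod_cast hx.one_le_cfDigit n
  have h3 := hx n
  have h4 := hx (n + 1)
  nlinarith [h3.1, h3.2, h4.1, h4.2, mul_nonneg h3.1.le (sub_nonneg.2 h2),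
    mul_nonneg h3.1.le (sub_nonneg.2 h4.2.le)]

theorem gaussProd_add_two_mul_le (n L : ℕ) :
    gaussProd x (n + 2 * L) ≤ gaussProd x n * (1 / 2) ^ L := by
  induction L with
  | zero => simp
  | succ L ih =>
    have := hx.gaussProd_add_two_le (n + 2 * L)
    rw [pow_succ, show n + 2 * (L + 1) = n + 2 * L + 2 by ring]
    linarith

theorem tendsto_gaussProd : Tendsto (gaussProd x) atTop (nhds 0) := by
  have h := tendsto_atTop_ciInf hx.gaussProd_antitone
    ⟨0, by rintro _ ⟨n, rfl⟩; exact (hx.gaussProd_pos n).le⟩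
  have h2 : Tendsto (fun n => gaussProd x (n + 2)) atTop (nhds (⨅ i, gaussProd x i)) :=
    h.comp (tendsto_add_atTop_nat 2)
  have h3 := le_of_tendsto_of_tendsto' h2 (h.div_const 2) hx.gaussProd_add_two_le
  have h4 : 0 ≤ ⨅ i, gaussProd x i := le_ciInf fun n => (hx.gaussProd_pos n).le
  have : ⨅ i, gaussProd x i = 0 := by linarith
  rwa [this] at h

theorem gaussProd_mul_cfDen (n : ℕ) :
    gaussProd x n * (cfDen x (n + 1) + gauss^[n] x * cfDen x n) = 1 := by
  induction n with
  | zero => simp [cfDen]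
  | succ n ih =>
    rw [gaussProd_succ, cfDen, ← ih]
    push_cast
    linear_combination (gaussProd x n * cfDen x (n + 1)) * hx.mul_inv_gauss n

theorem gaussProd_mul_cfNum (n : ℕ) :
    gaussProd x n * (cfNum x (n + 1) + gauss^[n] x * cfNum x n) = x := by
  induction n with
  | zero => simp [cfNum]
  | succ n ih =>
    rw [gaussProd_succ, cfNum]
    push_cast
    linear_combination (gaussProd x n * cfNum x (n + 1)) * hx.mul_inv_gauss n + ih

theorem cfDen_mul_sub_cfNum (n : ℕ) :
    cfDen x n * x - cfNum x n = (-1) ^ (n + 1) * gaussProd x n := by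
  induction n using Nat.twoStepInduction with
  | zero => simp [cfDen, cfNum]
  | one => simp [cfDen, cfNum, gaussProd_succ]
  | more n ih1 ih2 =>
    rw [cfDen, cfNum]
    push_cast
    have := hx.mul_inv_gauss n
    rw [gaussProd_succ, gaussProd_succ, pow_succ, pow_succ, pow_succ] at *
    linear_combination cfDigit x n * ih2 + ih1 + (-1) ^ n * gaussProd x n * this

theorem cfDen_nonneg (n : ℕ) : 0 ≤ cfDen x n := by
  induction n using Nat.twoStepInduction with
  | zero => simp [cfDen]
  | one => simp [cfDen]
  | more n ih1 ih2 =>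
    rw [cfDen]
    have := hx.one_le_cfDigit n
    positivity

theorem cfDen_le_succ (n : ℕ) : cfDen x n ≤ cfDen x (n + 1) := by
  cases n with
  | zero => simp [cfDen]
  | succ n =>
    rw [cfDen]
    nlinarith [hx.one_le_cfDigit n, hx.cfDen_nonneg n, hx.cfDen_nonneg (n + 1)]

theorem cfDen_succ_mul_gaussProd_le (n : ℕ) : cfDen x (n + 1) * gaussProd x n ≤ 1 := by
  have h := hx.gaussProd_mul_cfDen n
  have h1 : (0 : ℝ) ≤ cfDen x n := by exact_mod_cast hx.cfDen_nonneg n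
  nlinarith [mul_nonneg (hx.gaussProd_pos n).le (mul_nonneg (hx n).1.le h1)]

theorem cfDen_mul_gaussProd_le (n : ℕ) : cfDen x n * gaussProd x n ≤ 1 := by
  have h1 : (cfDen x n : ℝ) ≤ cfDen x (n + 1) := by exact_mod_cast hx.cfDen_le_succ n
  nlinarith [hx.cfDen_succ_mul_gaussProd_le n, hx.gaussProd_pos n]

/-- A number with nonterminating expansion is irrational. -/
theorem irrational : Irrational x := by
  rintro ⟨r, hr⟩
  have hd : (0 : ℝ) < r.den := by exact_mod_cast r.den_pos
  obtain ⟨n, hn⟩ := ((hx.tendsto_gaussProd.const_mul (r.den : ℝ)).eventually_lt_const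
    (u := 1) (by simp)).exists
  have h := congrArg abs (hx.cfDen_mul_sub_cfNum n)
  rw [abs_mul, abs_pow, abs_neg, abs_one, one_pow, one_mul,
    abs_of_pos (hx.gaussProd_pos n)] at h
  have hr' : (r.den : ℝ) * x = r.num := by
    rw [← hr]; exact_mod_cast Rat.den_mul_eq_num r
  have h2 : |((cfDen x n * r.num - r.den * cfNum x n : ℤ) : ℝ)| = r.den * gaussProd x n := by
    have : ((cfDen x n * r.num - r.den * cfNum x n : ℤ) : ℝ) =
        r.den * (cfDen x n * x - cfNum x n) := by
      push_cast
      linear_combination -(cfDen x n : ℝ) * hr'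
    rw [this, abs_mul, abs_of_pos hd, h]
  have h3 : 0 < |((cfDen x n * r.num - r.den * cfNum x n : ℤ) : ℝ)| := by
    rw [h2]; exact mul_pos hd (hx.gaussProd_pos n)
  have h4 : (0 : ℤ) < |cfDen x n * r.num - r.den * cfNum x n| := by exact_mod_cast h3
  have h5 : |(cfDen x n * r.num - r.den * cfNum x n)| < 1 := by
    rw [← h2] at hn; exact_mod_cast hn
  omega

end CFInfinite

/-- The bilinear relation `A + B t + C u + E t u = 0` between reals, with coefficients
`g = (A, B, C, E)`. -/
def bilinRel (g : ℤ × ℤ × ℤ × ℤ) (t u : ℝ) : Prop :=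
  g.1 + g.2.1 * t + g.2.2.1 * u + g.2.2.2 * (t * u) = 0

/-- The determinant of `(w, M v)`, where `w` is the `i`-th convergent vector of `y`, `v` is the
`j`-th convergent vector of `x` and `M` is the matrix with rows `(α, β)` and `(γ, δ)`. -/
noncomputable def convergentForm (α β γ δ : ℤ) (x y : ℝ) (i j : ℕ) : ℤ :=
  cfNum y i * (γ * cfNum x j + δ * cfDen x j) - cfDen y i * (α * cfNum x j + β * cfDen x j)

theorem convergentForm_det (α β γ δ : ℤ) (x y : ℝ) (n m : ℕ) :
    convergentForm α β γ δ x y (n + 1) (m + 1) * convergentForm α β γ δ x y n m -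
      convergentForm α β γ δ x y (n + 1) m * convergentForm α β γ δ x y n (m + 1) =
    (α * δ - β * γ) * (-1) ^ (n + m) := by
  have h1 := cfNum_mul_cfDen_sub x m
  have h2 := cfNum_mul_cfDen_sub y n
  have h3 : (-1 : ℤ) ^ (n + m) = (-1) ^ (n + 1) * (-1) ^ (m + 1) := by
    rw [pow_succ, pow_succ, pow_add]; ring
  rw [h3, ← h1, ← h2]
  unfold convergentForm
  ring

namespace CFInfinite

theorem convergent_bounds {x : ℝ} (hx : CFInfinite x) {n i : ℕ} (hi : i = n ∨ i = n + 1) :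
    |cfDen x i * x - cfNum x i| = gaussProd x i ∧ gaussProd x i ≤ gaussProd x n ∧
      0 ≤ (cfDen x i : ℝ) ∧ cfDen x i * gaussProd x n ≤ 1 := by
  refine ⟨?_, ?_, by exact_mod_cast hx.cfDen_nonneg i, ?_⟩
  · rw [hx.cfDen_mul_sub_cfNum, abs_mul, abs_pow, abs_neg, abs_one, one_pow, one_mul,
      abs_of_pos (hx.gaussProd_pos i)]
  · exact hx.gaussProd_antitone (by omega)
  · rcases hi with rfl | rfl
    · exact hx.cfDen_mul_gaussProd_le _
    · exact hx.cfDen_succ_mul_gaussProd_le _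

variable {α β γ δ : ℤ} {x y ρ : ℝ}

theorem abs_convergentForm_le (hx : CFInfinite x) (hy : CFInfinite y)
    (h1 : α * x + β = ρ * y) (h2 : γ * x + δ = ρ) (i j : ℕ) :
    |(convergentForm α β γ δ x y i j : ℝ)| ≤ (|(α : ℝ)| + |(γ : ℝ)| + |ρ|) *
      (cfDen y i * gaussProd x j + cfDen x j * gaussProd y i +
        gaussProd x j * gaussProd y i) := by
  obtain ⟨hr, -, hq, -⟩ := hx.convergent_bounds (n := j) (i := j) (Or.inl rfl)
  obtain ⟨hr', -, hq', -⟩ := hy.convergent_bounds (n := i) (i := i) (Or.inl rfl)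
  have hy1 : |y| ≤ 1 := abs_le.2 ⟨by linarith [(hy 0).1, show gauss^[0] y = y from rfl],
    by linarith [(hy 0).2, show gauss^[0] y = y from rfl]⟩
  have key : (convergentForm α β γ δ x y i j : ℝ) =
      (α - γ * y) * (cfDen y i * (cfDen x j * x - cfNum x j)) -
        ρ * (cfDen x j * (cfDen y i * y - cfNum y i)) +
        γ * ((cfDen x j * x - cfNum x j) * (cfDen y i * y - cfNum y i)) := by
    unfold convergentForm
    push_cast
    linear_combination (-cfDen y i * cfDen x j : ℝ) * h1 + (cfNum y i * cfDen x j : ℝ) * h2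
  have hx0 := (hx.gaussProd_pos j).le
  have hy0 := (hy.gaussProd_pos i).le
  have e1 : |(α - γ * y : ℝ)| ≤ |(α : ℝ)| + |(γ : ℝ)| := by
    refine (abs_sub _ _).trans ?_
    rw [abs_mul]
    nlinarith [abs_nonneg (γ : ℝ), abs_nonneg y]
  rw [key]
  refine (abs_add_le _ _).trans ((add_le_add_left (abs_sub _ _) _).trans ?_)
  simp only [abs_mul, hr, hr', abs_of_nonneg hq, abs_of_nonneg hq']
  have a1 := mul_nonneg hq' hx0
  have a2 := mul_nonneg hq hy0
  have a3 := mul_nonneg hx0 hy0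
  nlinarith [mul_le_mul_of_nonneg_right e1 a1, mul_nonneg (abs_nonneg (α : ℝ)) a2,
    mul_nonneg (abs_nonneg (α : ℝ)) a3, mul_nonneg (abs_nonneg (γ : ℝ)) a2,
    mul_nonneg (abs_nonneg ρ) a1, mul_nonneg (abs_nonneg ρ) a3]

theorem bilinRel_convergentForm (hx : CFInfinite x) (hy : CFInfinite y)
    (h1 : α * x + β = ρ * y) (h2 : γ * x + δ = ρ) (n m : ℕ) :
    bilinRel (convergentForm α β γ δ x y (n + 1) (m + 1), convergentForm α β γ δ x y (n + 1) m,
      convergentForm α β γ δ x y n (m + 1), convergentForm α β γ δ x y n m)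
      (gauss^[m] x) (gauss^[n] y) := by
  have a1 := hx.gaussProd_mul_cfDen m
  have a2 := hx.gaussProd_mul_cfNum m
  have b1 := hy.gaussProd_mul_cfDen n
  have b2 := hy.gaussProd_mul_cfNum n
  have hne : gaussProd x m * gaussProd y n ≠ 0 :=
    mul_ne_zero (hx.gaussProd_pos m).ne' (hy.gaussProd_pos n).ne'
  refine (mul_eq_zero.1 ?_).resolve_left hne
  have : gaussProd x m * gaussProd y n * ((convergentForm α β γ δ x y (n + 1) (m + 1) : ℝ) +
      convergentForm α β γ δ x y (n + 1) m * gauss^[m] x +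
      convergentForm α β γ δ x y n (m + 1) * gauss^[n] y +
      convergentForm α β γ δ x y n m * (gauss^[m] x * gauss^[n] y)) =
      (gaussProd y n * (cfNum y (n + 1) + gauss^[n] y * cfNum y n)) *
        (γ * (gaussProd x m * (cfNum x (m + 1) + gauss^[m] x * cfNum x m)) +
          δ * (gaussProd x m * (cfDen x (m + 1) + gauss^[m] x * cfDen x m))) -
      (gaussProd y n * (cfDen y (n + 1) + gauss^[n] y * cfDen y n)) *
        (α * (gaussProd x m * (cfNum x (m + 1) + gauss^[m] x * cfNum x m)) +
          β * (gaussProd x m * (cfDen x (m + 1) + gauss^[m] x * cfDen x m))) := by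
    unfold convergentForm
    push_cast
    ring
  rw [this, a1, a2, b1, b2]
  linear_combination y * h2 - h1

theorem convergentForm_ne_zero (hD : α * δ - β * γ ≠ 0) (n m : ℕ) :
    convergentForm α β γ δ x y n m ≠ 0 ∨ convergentForm α β γ δ x y (n + 1) m ≠ 0 := by
  by_contra! h
  have := convergentForm_det α β γ δ x y n m
  rw [h.1, h.2, mul_zero, zero_mul, sub_zero] at this
  exact mul_ne_zero hD (by simp) this.symm

/-- Each tail product of `y` is comparable to a tail product of `x`. -/
theorem exists_comparable (hx : CFInfinite x) (hy : CFInfinite y)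
    (hD : α * δ - β * γ ≠ 0) (h1 : α * x + β = ρ * y) (h2 : γ * x + δ = ρ) :
    ∃ ε > 0, ε ≤ 1 ∧ ∀ n, ∃ m, ε * gaussProd y n ≤ gaussProd x m ∧
      ε * gaussProd x m ≤ gaussProd y n := by
  set K : ℝ := |(α : ℝ)| + |(γ : ℝ)| + |ρ| with hK
  have hK0 : 0 ≤ K := by positivity
  have hε : 0 < 1 / (3 * K + 1) := by positivity
  have hε1 : 1 / (3 * K + 1) ≤ 1 := by rw [div_le_one (by positivity)]; linarith
  refine ⟨1 / (3 * K + 1), hε, hε1, fun n => ?_⟩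
  set ε := 1 / (3 * K + 1) with hεdef
  have hKε : K * (3 * ε) < 1 := by
    rw [hεdef]
    rw [← mul_assoc, mul_one_div, div_lt_one (by positivity)]
    linarith
  classical
  have hex : ∃ k, gaussProd x k < gaussProd y n :=
    (hx.tendsto_gaussProd.eventually_lt_const (hy.gaussProd_pos n)).exists
  obtain ⟨m, hm⟩ : ∃ m, Nat.find hex = m + 1 := by
    refine Nat.exists_eq_succ_of_ne_zero fun h0 => ?_
    have := Nat.find_spec hex
    rw [h0, gaussProd_zero] at this
    linarith [hy.gaussProd_le_one n]
  have hlt : gaussProd x (m + 1) < gaussProd y n := hm ▸ Nat.find_spec hex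
  have hge : gaussProd y n ≤ gaussProd x m :=
    not_lt.1 (Nat.find_min hex (m := m) (by omega))
  have hyp := hy.gaussProd_pos n
  have hxp := hx.gaussProd_pos m
  have hxp' := hx.gaussProd_pos (m + 1)
  by_cases c1 : ε * gaussProd y n ≤ gaussProd x (m + 1)
  · exact ⟨m + 1, c1, by nlinarith⟩
  by_cases c2 : ε * gaussProd x m ≤ gaussProd y n
  · exact ⟨m, by nlinarith, c2⟩
  exfalso
  push Not at c1 c2
  have small : ∀ i, i = n ∨ i = n + 1 → convergentForm α β γ δ x y i (m + 1) = 0 := by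
    intro i hi
    obtain ⟨-, e1, e2, e3⟩ := hy.convergent_bounds hi
    obtain ⟨-, -, f2, f3⟩ := hx.convergent_bounds (n := m) (i := m + 1) (Or.inr rfl)
    have hb := abs_convergentForm_le hx hy h1 h2 i (m + 1)
    have hyi := hy.gaussProd_pos i
    have g1 : cfDen y i * gaussProd x (m + 1) ≤ ε := by
      nlinarith [mul_le_mul_of_nonneg_left c1.le e2]
    have g2 : cfDen x (m + 1) * gaussProd y i ≤ ε := by
      nlinarith [mul_le_mul_of_nonneg_left (e1.trans c2.le) f2]
    have g3 : gaussProd x (m + 1) * gaussProd y i ≤ ε := by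
      nlinarith [hy.gaussProd_le_one n, hy.gaussProd_le_one i]
    have : |(convergentForm α β γ δ x y i (m + 1) : ℝ)| < 1 := by
      refine hb.trans_lt (lt_of_le_of_lt ?_ hKε)
      exact mul_le_mul_of_nonneg_left (by linarith) hK0
    exact Int.abs_lt_one_iff.1 (by exact_mod_cast this)
  rcases convergentForm_ne_zero (x := x) (y := y) hD n (m + 1) with h | h
  · exact h (small _ (Or.inl rfl))
  · exact h (small _ (Or.inr rfl))

theorem abs_convergentForm_le_of_comparable (hx : CFInfinite x) (hy : CFInfinite y)
    (h1 : α * x + β = ρ * y) (h2 : γ * x + δ = ρ) {ε : ℝ} (hε : 0 < ε) {n m i j : ℕ}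
    (hc1 : ε * gaussProd y n ≤ gaussProd x m) (hc2 : ε * gaussProd x m ≤ gaussProd y n)
    (hi : i = n ∨ i = n + 1) (hj : j = m ∨ j = m + 1) :
    |(convergentForm α β γ δ x y i j : ℝ)| ≤
      (|(α : ℝ)| + |(γ : ℝ)| + |ρ|) * (2 / ε + 1) := by
  refine (abs_convergentForm_le hx hy h1 h2 i j).trans ?_
  obtain ⟨-, e1, e2, e3⟩ := hy.convergent_bounds hi
  obtain ⟨-, f1, f2, f3⟩ := hx.convergent_bounds hj
  have hyi := hy.gaussProd_pos i
  have hxj := hx.gaussProd_pos j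
  have g1 : cfDen y i * gaussProd x j ≤ 1 / ε := by
    rw [le_div_iff₀ hε]
    nlinarith [mul_le_mul_of_nonneg_left hc2 e2, mul_le_mul_of_nonneg_left f1 e2]
  have g2 : cfDen x j * gaussProd y i ≤ 1 / ε := by
    rw [le_div_iff₀ hε]
    nlinarith [mul_le_mul_of_nonneg_left hc1 f2, mul_le_mul_of_nonneg_left e1 f2]
  have g3 : gaussProd x j * gaussProd y i ≤ 1 := by
    nlinarith [hy.gaussProd_le_one i, hx.gaussProd_le_one j]
  refine mul_le_mul_of_nonneg_left ?_ (by positivity)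
  have : 2 / ε = 1 / ε + 1 / ε := by ring
  linarith

theorem exists_gaussProd_add_lt (hx : CFInfinite x) {ε : ℝ} (hε : 0 < ε) :
    ∃ P : ℕ, ∀ k n, k + P ≤ n → gaussProd x n < ε * gaussProd x k := by
  obtain ⟨L, hL⟩ := exists_pow_lt_of_lt_one hε (show (1 / 2 : ℝ) < 1 by norm_num)
  refine ⟨2 * L, fun k n hn => ?_⟩
  have h1 := hx.gaussProd_antitone hn
  have h2 := hx.gaussProd_add_two_mul_le k L
  have h3 := hx.gaussProd_pos k
  nlinarith

end CFInfinite

theorem Finset.card_le_of_forall_lt_add {S : Finset ℕ} {P : ℕ}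
    (h : ∀ a ∈ S, ∀ b ∈ S, a < b + P) : S.card ≤ P := by
  rcases S.eq_empty_or_nonempty with rfl | hS
  · simp
  have : S ⊆ Finset.Ico (S.min' hS) (S.min' hS + P) := fun a ha =>
    Finset.mem_Ico.2 ⟨Finset.min'_le _ _ ha, h a ha _ (Finset.min'_mem _ _)⟩
  simpa using Finset.card_le_card this

/-- Matching of the indices of two sequences of comparable decay. -/
theorem exists_index_matching {a b : ℕ → ℝ} {ε : ℝ} (hε : 0 < ε) (ha : Antitone a)
    {P : ℕ} (ha' : ∀ k n, k + P ≤ n → a n < ε ^ 2 * a k)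
    (hb' : ∀ k n, k + P ≤ n → b n < ε ^ 2 * b k) {m : ℕ → ℕ}
    (hm : ∀ n, ε * b n ≤ a (m n) ∧ ε * a (m n) ≤ b n)
    (hrev : ∀ j, ∃ n, ε * a j ≤ b n ∧ ε * b n ≤ a j) (n : ℕ) :
    m n < (P + 1) * (n + P + 1) ∧
      ∀ S : Finset ℕ, (∀ i ∈ S, m i = n) → S.card ≤ P := by
  constructor
  · choose r hr using hrev
    have hmap : ∀ j ∈ Finset.range (m n + 1), r j ∈ Finset.range (n + P) := by
      intro j hj
      rw [Finset.mem_range] at hj ⊢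
      by_contra! hc
      have h1 := hb' n (r j) hc
      have h2 := (hr j).1
      have h3 := ha (show j ≤ m n by omega)
      have h4 := (hm n).1
      nlinarith
    have hfib : ∀ k ∈ Finset.range (n + P),
        ((Finset.range (m n + 1)).filter fun j => r j = k).card ≤ P := by
      intro k _
      refine Finset.card_le_of_forall_lt_add fun i hi j hj => ?_
      rw [Finset.mem_filter] at hi hj
      by_contra! hc
      have h1 := ha' j i hc
      have h2 := (hr i).2
      have h3 := (hr j).1
      rw [hi.2] at h2
      rw [hj.2] at h3
      nlinarith
    have := Finset.card_le_mul_card_image_of_maps_to hmap P hfib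
    simp only [Finset.card_range] at this
    nlinarith
  · intro S hS
    refine Finset.card_le_of_forall_lt_add fun i hi j hj => ?_
    by_contra! hc
    have h1 := hb' j i hc
    have h2 := (hm i).2
    have h3 := (hm j).1
    rw [hS i hi] at h2
    rw [hS j hj] at h3
    nlinarith

open scoped Classical in
/-- Visits of the orbit of `y` to `E` are controlled by visits of the orbit of `x` to finitely
many images of `E` under nondegenerate linear fractional relations. -/
theorem exists_card_visits_le {α β γ δ : ℤ} {x y ρ : ℝ} (hx : CFInfinite x) (hy : CFInfinite y)
    (hD : α * δ - β * γ ≠ 0) (hρ : ρ ≠ 0) (h1 : α * x + β = ρ * y) (h2 : γ * x + δ = ρ) :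
    ∃ (G : Finset (ℤ × ℤ × ℤ × ℤ)) (B : ℕ),
      (∀ g ∈ G, g.1 * g.2.2.2 - g.2.1 * g.2.2.1 ≠ 0) ∧
      ∀ (E : Set ℝ) (N : ℕ), ((Finset.range N).filter fun n => gauss^[n] y ∈ E).card ≤
        B * ∑ g ∈ G, ((Finset.range (B * (N + B))).filter
          fun k => ∃ u ∈ E, bilinRel g (gauss^[k] x) u).card := by
  obtain ⟨ε₁, hε₁, hε₁', hm⟩ := hx.exists_comparable hy hD h1 h2
  have hr1 : ((δ : ℤ) : ℝ) * y + ((-β : ℤ) : ℝ) = ((α * δ - β * γ : ℤ) / ρ) * x := by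
    field_simp
    push_cast
    linear_combination -δ * h1 + β * h2
  have hr2 : ((-γ : ℤ) : ℝ) * y + ((α : ℤ) : ℝ) = (α * δ - β * γ : ℤ) / ρ := by
    field_simp
    push_cast
    linear_combination γ * h1 - α * h2
  obtain ⟨ε₂, hε₂, hε₂', hrev⟩ := hy.exists_comparable hx
    (show δ * α - (-β) * (-γ) ≠ 0 by contrapose! hD; linarith) hr1 hr2
  set ε := min ε₁ ε₂ with hεdef
  have hε : 0 < ε := lt_min hε₁ hε₂
  choose m hm using hm
  replace hm : ∀ n, ε * gaussProd y n ≤ gaussProd x (m n) ∧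
      ε * gaussProd x (m n) ≤ gaussProd y n := fun n =>
    ⟨(mul_le_mul_of_nonneg_right (min_le_left _ _) (hy.gaussProd_pos _).le).trans (hm n).1,
      (mul_le_mul_of_nonneg_right (min_le_left _ _) (hx.gaussProd_pos _).le).trans (hm n).2⟩
  replace hrev : ∀ j, ∃ n, ε * gaussProd x j ≤ gaussProd y n ∧
      ε * gaussProd y n ≤ gaussProd x j := fun j => (hrev j).imp fun n hn =>
    ⟨(mul_le_mul_of_nonneg_right (min_le_right _ _) (hx.gaussProd_pos _).le).trans hn.1,
      (mul_le_mul_of_nonneg_right (min_le_right _ _) (hy.gaussProd_pos _).le).trans hn.2⟩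
  obtain ⟨P₁, hP₁⟩ := hx.exists_gaussProd_add_lt (pow_pos hε 2)
  obtain ⟨P₂, hP₂⟩ := hy.exists_gaussProd_add_lt (pow_pos hε 2)
  set P := P₁ + P₂
  have match' := exists_index_matching hε hx.gaussProd_antitone
    (P := P) (fun k n h => hP₁ k n (by omega)) (fun k n h => hP₂ k n (by omega)) hm hrev
  obtain ⟨W, hW⟩ := exists_nat_ge ((|(α : ℝ)| + |(γ : ℝ)| + |ρ|) * (2 / ε + 1))
  set I : Finset ℤ := Finset.Icc (-(W : ℤ)) W
  have hI : ∀ n i j, (i = n ∨ i = n + 1) → (j = m n ∨ j = m n + 1) →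
      convergentForm α β γ δ x y i j ∈ I := by
    intro n i j hi hj
    have h := (hx.abs_convergentForm_le_of_comparable hy h1 h2 hε (hm n).1 (hm n).2 hi hj).trans hW
    rw [Finset.mem_Icc, ← abs_le]
    exact_mod_cast h
  refine ⟨(I ×ˢ I ×ˢ I ×ˢ I).filter fun g => g.1 * g.2.2.2 - g.2.1 * g.2.2.1 ≠ 0, P + 1,
    fun g hg => (Finset.mem_filter.1 hg).2, fun E N => ?_⟩
  set G := (I ×ˢ I ×ˢ I ×ˢ I).filter fun g => g.1 * g.2.2.2 - g.2.1 * g.2.2.1 ≠ 0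
  set U := G.biUnion fun g => (Finset.range ((P + 1) * (N + (P + 1)))).filter
          fun k => ∃ u ∈ E, bilinRel g (gauss^[k] x) u with hU
  have hmaps : ∀ n ∈ (Finset.range N).filter fun n => gauss^[n] y ∈ E, m n ∈ U := by
    intro n hn
    rw [Finset.mem_filter, Finset.mem_range] at hn
    rw [hU, Finset.mem_biUnion]
    refine ⟨_, ?_, Finset.mem_filter.2 ⟨?_, _, hn.2, hx.bilinRel_convergentForm hy h1 h2 n (m n)⟩⟩
    · rw [Finset.mem_filter]
      refine ⟨?_, ?_⟩
      · simp only [Finset.mem_product]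
        exact ⟨hI n _ _ (Or.inr rfl) (Or.inr rfl), hI n _ _ (Or.inr rfl) (Or.inl rfl),
          hI n _ _ (Or.inl rfl) (Or.inr rfl), hI n _ _ (Or.inl rfl) (Or.inl rfl)⟩
      · rw [convergentForm_det]
        exact mul_ne_zero hD (by simp)
    · rw [Finset.mem_range]
      refine (match' n).1.trans_le (Nat.mul_le_mul_left _ (by omega))
  refine (Finset.card_le_mul_card_image_of_maps_to hmaps (P + 1) fun k _ => ?_).trans
    (Nat.mul_le_mul_left _ Finset.card_biUnion_le)
  exact ((match' k).2 _ fun i hi => (Finset.mem_filter.1 hi).2).trans (Nat.le_succ _)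

/-! ### Cylinders -/

/-- The list of the first `k` partial quotients of `x`. -/
noncomputable def cfDigits (x : ℝ) (k : ℕ) : List ℤ := (List.range k).map (cfDigit x)

theorem mem_cyl_cfDigits {x z : ℝ} {k : ℕ} :
    z ∈ cyl (cfDigits x k) ↔ z ∈ Set.Ico (0 : ℝ) 1 ∧ ∀ i < k, cfDigit z i = cfDigit x i := by
  unfold cyl cfDigits
  simp only [Set.mem_ofPred_eq, List.length_map, List.length_range]
  refine and_congr_right fun _ => forall₂_congr fun i hi => ?_
  rw [List.getD_eq_getElem _ _ (by simpa using hi)]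
  simp

theorem CFInfinite.mem_Ico {x : ℝ} (hx : CFInfinite x) : x ∈ Set.Ico (0 : ℝ) 1 :=
  ⟨(hx 0).1.le, (hx 0).2⟩

theorem CFInfinite.mem_cyl_cfDigits_self {x : ℝ} (hx : CFInfinite x) (k : ℕ) :
    x ∈ cyl (cfDigits x k) :=
  mem_cyl_cfDigits.2 ⟨hx.mem_Ico, fun _ _ => rfl⟩

theorem cfNum_congr {x z : ℝ} {k : ℕ} (h : ∀ i < k, cfDigit z i = cfDigit x i) {n : ℕ}
    (hn : n ≤ k + 1) : cfNum z n = cfNum x n := by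
  induction n using Nat.twoStepInduction with
  | zero => rfl
  | one => rfl
  | more n ih1 ih2 => rw [cfNum, cfNum, ih1 (by omega), ih2 (by omega), h n (by omega)]

theorem cfDen_congr {x z : ℝ} {k : ℕ} (h : ∀ i < k, cfDigit z i = cfDigit x i) {n : ℕ}
    (hn : n ≤ k + 1) : cfDen z n = cfDen x n := by
  induction n using Nat.twoStepInduction with
  | zero => rfl
  | one => rfl
  | more n ih1 ih2 => rw [cfDen, cfDen, ih1 (by omega), ih2 (by omega), h n (by omega)]

namespace CFInfinite

variable {x z : ℝ} {k : ℕ}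

/-- Points with the same first `k` partial quotients: exact distance formula. -/
theorem abs_sub_eq (hx : CFInfinite x) (hz : CFInfinite z)
    (h : ∀ i < k, cfDigit z i = cfDigit x i) :
    |x - z| = gaussProd x k * gaussProd z k * |gauss^[k] x - gauss^[k] z| := by
  have a1 := hx.gaussProd_mul_cfDen k
  have a2 := hx.gaussProd_mul_cfNum k
  have b1 := hz.gaussProd_mul_cfDen k
  have b2 := hz.gaussProd_mul_cfNum k
  have d : ((cfNum x (k + 1) * cfDen x k - cfNum x k * cfDen x (k + 1) : ℤ) : ℝ) =
    ((-1) ^ (k + 1) : ℤ) := by rw [cfNum_mul_cfDen_sub x k]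
  push_cast at d
  rw [cfDen_congr h le_rfl, cfDen_congr h (Nat.le_succ _)] at b1
  rw [cfNum_congr h le_rfl, cfNum_congr h (Nat.le_succ _)] at b2
  have key : x - z = gaussProd x k * gaussProd z k *
      ((gauss^[k] z - gauss^[k] x) * (-1) ^ (k + 1)) := by
    rw [← d]
    calc x - z = x * 1 - z * 1 := by ring
      _ = (gaussProd x k * (cfNum x (k + 1) + gauss^[k] x * cfNum x k)) *
            (gaussProd z k * (cfDen x (k + 1) + gauss^[k] z * cfDen x k)) -
          (gaussProd z k * (cfNum x (k + 1) + gauss^[k] z * cfNum x k)) *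
            (gaussProd x k * (cfDen x (k + 1) + gauss^[k] x * cfDen x k)) := by
          rw [a1, a2, b1, b2]
      _ = _ := by ring
  rw [key, abs_mul, abs_mul, abs_mul, abs_pow, abs_neg, abs_one, one_pow, mul_one,
    abs_of_pos (hx.gaussProd_pos k), abs_of_pos (hz.gaussProd_pos k), abs_sub_comm]

theorem gaussProd_le_two_mul (hx : CFInfinite x) (hz : CFInfinite z)
    (h : ∀ i < k, cfDigit z i = cfDigit x i) : gaussProd x k ≤ 2 * gaussProd z k := by
  have a := hx.cfDen_succ_mul_gaussProd_le k
  have b1 := hz.gaussProd_mul_cfDen k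
  rw [cfDen_congr h le_rfl, cfDen_congr h (Nat.le_succ _)] at b1
  have q0 : (0 : ℝ) ≤ cfDen x k := by exact_mod_cast hx.cfDen_nonneg k
  have q1 : (cfDen x k : ℝ) ≤ cfDen x (k + 1) := by exact_mod_cast hx.cfDen_le_succ k
  have hz1 := hz k
  have hzp := hz.gaussProd_pos k
  have hxp := hx.gaussProd_pos k
  have : 1 ≤ gaussProd z k * (2 * cfDen x (k + 1)) := by
    rw [← b1]
    refine mul_le_mul_of_nonneg_left ?_ hzp.le
    nlinarith [hz1.1, hz1.2]
  nlinarith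

theorem exists_forall_mem_of_isOpen (hx : CFInfinite x) {U : Set ℝ} (hU : IsOpen U)
    (hxU : x ∈ U) : ∃ k, k ≠ 0 ∧ ∀ z, CFInfinite z → z ∈ cyl (cfDigits x k) → z ∈ U := by
  obtain ⟨r, hr, hball⟩ := Metric.isOpen_iff.1 hU x hxU
  obtain ⟨k, hk, hk0⟩ := ((hx.tendsto_gaussProd.eventually_lt_const hr).and
    (eventually_ne_atTop 0)).exists
  refine ⟨k, hk0, fun z hz hzc => hball ?_⟩
  rw [Metric.mem_ball, dist_comm, Real.dist_eq, hx.abs_sub_eq hz (mem_cyl_cfDigits.1 hzc).2]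
  have h1 : |gauss^[k] x - gauss^[k] z| ≤ 1 := by
    have := hx k
    have := hz k
    rw [Set.mem_Ioo] at *
    exact abs_le.2 ⟨by linarith, by linarith⟩
  have hxp := hx.gaussProd_pos k
  have hzp := hz.gaussProd_pos k
  have hz1 := hz.gaussProd_le_one k
  calc gaussProd x k * gaussProd z k * |gauss^[k] x - gauss^[k] z|
      ≤ gaussProd x k * 1 * 1 := by gcongr
    _ < r := by linarith

end CFInfinite

/-- Up to points with terminating expansion, an open set is a disjoint union of cylinders. -/
theorem exists_disjoint_cyl_cover {U : Set ℝ} (hU : IsOpen U) :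
    ∃ S : Set (List ℤ), (∀ s ∈ S, s ≠ [] ∧ ∀ c ∈ s, 0 < c) ∧
      (∀ s ∈ S, ∃ t, CFInfinite t ∧ t ∈ cyl s) ∧ S.PairwiseDisjoint cyl ∧
      ∀ z, CFInfinite z → ((∃ s ∈ S, z ∈ cyl s) ↔ z ∈ U) := by
  classical
  have hex : ∀ t : {t // CFInfinite t ∧ t ∈ U}, ∃ k, k ≠ 0 ∧
      ∀ z, CFInfinite z → z ∈ cyl (cfDigits t k) → z ∈ U := fun t =>
    t.2.1.exists_forall_mem_of_isOpen hU t.2.2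
  refine ⟨Set.range fun t : {t // CFInfinite t ∧ t ∈ U} => cfDigits t (Nat.find (hex t)),
    ?_, ?_, ?_, ?_⟩
  · rintro _ ⟨t, rfl⟩
    refine ⟨by simp [cfDigits], fun c hc => ?_⟩
    obtain ⟨i, -, rfl⟩ := List.mem_map.1 hc
    exact t.2.1.one_le_cfDigit i
  · rintro _ ⟨t, rfl⟩
    exact ⟨t, t.2.1, t.2.1.mem_cyl_cfDigits_self _⟩
  · have key : ∀ (t t' : {t // CFInfinite t ∧ t ∈ U}) (z : ℝ),
        z ∈ cyl (cfDigits t (Nat.find (hex t))) → z ∈ cyl (cfDigits t' (Nat.find (hex t'))) →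
        Nat.find (hex t) ≤ Nat.find (hex t') →
        cfDigits t (Nat.find (hex t)) = cfDigits t' (Nat.find (hex t')) := by
      intro t t' z hz hz' hle
      have h1 := (mem_cyl_cfDigits.1 hz).2
      have h2 := (mem_cyl_cfDigits.1 hz').2
      have h3 : cfDigits t (Nat.find (hex t)) = cfDigits t' (Nat.find (hex t)) :=
        List.map_congr_left fun i hi => by
          have hi' := List.mem_range.1 hi
          rw [← h1 i hi', h2 i (by omega)]
      have h4 : Nat.find (hex t') ≤ Nat.find (hex t) :=
        Nat.find_min' _ (by rw [← h3]; exact Nat.find_spec (hex t))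
      rw [h3, le_antisymm hle h4]
    rintro _ ⟨t, rfl⟩ _ ⟨t', rfl⟩ hne
    refine Set.disjoint_left.2 fun z hz hz' => hne ?_
    rcases le_total (Nat.find (hex t)) (Nat.find (hex t')) with h | h
    · exact key t t' z hz hz' h
    · exact (key t' t z hz' hz h).symm
  · refine fun z hz => ⟨?_, fun hzU => ⟨_, ⟨⟨z, hz, hzU⟩, rfl⟩, hz.mem_cyl_cfDigits_self _⟩⟩
    rintro ⟨_, ⟨t, rfl⟩, hzt⟩
    exact (Nat.find_spec (hex t)).2 z hz hzt

theorem measurable_gauss : Measurable gauss := by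
  have : gauss = fun x => Int.fract x⁻¹ := funext gauss_eq_fract
  rw [this]
  fun_prop

theorem measurable_cfDigit (i : ℕ) : Measurable fun x => cfDigit x i :=
  (measurable_gauss.iterate i).inv.floor

theorem measurableSet_cyl (s : List ℤ) : MeasurableSet (cyl s) := by
  have : cyl s = Set.Ico 0 1 ∩ ⋂ i ∈ Finset.range s.length,
      (fun x => cfDigit x i) ⁻¹' {s.getD i 0} := by
    ext x; simp [cyl]
  rw [this]
  exact measurableSet_Ico.inter (Finset.measurableSet_biInter _ fun i _ =>
    measurable_cfDigit i (measurableSet_singleton _))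

/-- Every infinite expansion can be prefixed by any string of positive integers. -/
theorem exists_mem_cyl_gauss_iterate_eq {s : List ℤ} (hs : ∀ c ∈ s, 0 < c) {z : ℝ}
    (hz : CFInfinite z) : ∃ t, CFInfinite t ∧ t ∈ cyl s ∧ gauss^[s.length] t = z := by
  induction s with
  | nil => exact ⟨z, hz, ⟨hz.mem_Ico, by simp⟩, rfl⟩
  | cons a s ih =>
    obtain ⟨t, ht, hts, rfl⟩ := ih fun c hc => hs c (List.mem_cons_of_mem _ hc)
    have ha : (1 : ℝ) ≤ a := by exact_mod_cast hs a List.mem_cons_self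
    have ht0 := ht 0
    simp only [Function.iterate_zero, id_eq, Set.mem_Ioo] at ht0
    have hg : gauss (a + t)⁻¹ = t := by
      rw [gauss_eq_fract, inv_inv, Int.fract_intCast_add, Int.fract_eq_self.2 ⟨ht0.1.le, ht0.2⟩]
    have hmem : (a + t)⁻¹ ∈ Set.Ioo (0 : ℝ) 1 :=
      ⟨by have : 0 < a + t := by linarith
          positivity, inv_lt_one_of_one_lt₀ (by linarith)⟩
    refine ⟨(a + t)⁻¹, fun n => ?_, ⟨⟨hmem.1.le, hmem.2⟩, fun i hi => ?_⟩, ?_⟩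
    · cases n with
      | zero => exact hmem
      | succ n => rw [Function.iterate_succ_apply, hg]; exact ht n
    · cases i with
      | zero =>
        simp only [cfDigit, Function.iterate_zero, id_eq, inv_inv, List.getD_cons_zero]
        rw [Int.floor_eq_iff]
        exact ⟨by linarith, by linarith⟩
      | succ i =>
        rw [List.getD_cons_succ, cfDigit, Function.iterate_succ_apply, hg]
        exact hts.2 i (by simpa using hi)
    · rw [List.length_cons, Function.iterate_succ_apply, hg]

/-! ### Lebesgue and Gauss measure -/

theorem ae_cfInfinite : ∀ᵐ x ∂(volume.restrict (Set.Ico (0 : ℝ) 1)), CFInfinite x := by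
  have h : ∀ᵐ x ∂(volume : Measure ℝ), Irrational x := by
    have := (Set.countable_range ((↑) : ℚ → ℝ)).ae_notMem (volume : Measure ℝ)
    exact this
  filter_upwards [ae_restrict_of_ae h, ae_restrict_mem measurableSet_Ico] with x hx hx'
  exact cfInfinite_of_irrational hx hx'

theorem gaussMeasure_absolutelyContinuous :
    gaussMeasure ≪ volume.restrict (Set.Ico (0 : ℝ) 1) :=
  withDensity_absolutelyContinuous _ _

theorem ae_gaussMeasure_cfInfinite : ∀ᵐ x ∂gaussMeasure, CFInfinite x :=
  gaussMeasure_absolutelyContinuous.ae_le ae_cfInfinite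

theorem measurable_gaussDensity :
    Measurable fun x : ℝ => ENNReal.ofReal (1 / (Real.log 2 * (1 + x))) := by
  fun_prop

theorem gaussMeasure_le (E : Set ℝ) :
    gaussMeasure E ≤ 2 * volume.restrict (Set.Ico (0 : ℝ) 1) E := by
  have : gaussMeasure ≤ (2 : ℝ≥0∞) • volume.restrict (Set.Ico (0 : ℝ) 1) := by
    rw [← withDensity_const]
    refine withDensity_mono ?_
    filter_upwards [ae_restrict_mem measurableSet_Ico] with x hx
    have h2 := Real.log_two_gt_d9
    rw [show (2 : ℝ≥0∞) = ENNReal.ofReal 2 by simp]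
    refine ENNReal.ofReal_le_ofReal ?_
    rw [div_le_iff₀ (by nlinarith [hx.1])]
    nlinarith [hx.1]
  exact this E

theorem restrict_le_gaussMeasure (E : Set ℝ) :
    volume.restrict (Set.Ico (0 : ℝ) 1) E ≤ 2 * gaussMeasure E := by
  have : volume.restrict (Set.Ico (0 : ℝ) 1) ≤ (2 : ℝ≥0∞) • gaussMeasure := by
    rw [gaussMeasure, ← withDensity_smul _ measurable_gaussDensity]
    conv_lhs => rw [← withDensity_one (μ := volume.restrict (Set.Ico (0 : ℝ) 1))]
    refine withDensity_mono ?_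
    filter_upwards [ae_restrict_mem measurableSet_Ico] with x hx
    have h2 := Real.log_two_lt_d9
    have h3 := Real.log_two_gt_d9
    simp only [Pi.one_apply, Pi.smul_apply, smul_eq_mul]
    rw [show (2 : ℝ≥0∞) = ENNReal.ofReal 2 by simp, ← ENNReal.ofReal_mul (by norm_num),
      ← ENNReal.ofReal_one]
    refine ENNReal.ofReal_le_ofReal ?_
    rw [mul_one_div, le_div_iff₀ (by nlinarith [hx.1])]
    nlinarith [hx.1, hx.2]
  exact this E

theorem gaussMeasure_Icc {b c : ℝ} (hb : 0 ≤ b) (hbc : b ≤ c) (hc : c ≤ 1) :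
    gaussMeasure (Set.Icc b c) =
      ENNReal.ofReal ((Real.log (1 + c) - Real.log (1 + b)) / Real.log 2) := by
  have hl : 0 < Real.log 2 := Real.log_pos (by norm_num)
  have hcont : ContinuousOn (fun x : ℝ => 1 / (Real.log 2 * (1 + x))) (Set.Icc b c) := by
    refine ContinuousOn.div (by fun_prop) (by fun_prop) fun x hx => ?_
    have : 0 < 1 + x := by linarith [hx.1]
    positivity
  rw [gaussMeasure, withDensity_apply _ measurableSet_Icc,
    Measure.restrict_restrict measurableSet_Icc]
  have hae : (Set.Icc b c ∩ Set.Ico 0 1 : Set ℝ) =ᵐ[volume] Set.Ioc b c := by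
    have h1 : (Set.Ico (0 : ℝ) 1 : Set ℝ) =ᵐ[volume] Set.Icc 0 1 := Ico_ae_eq_Icc
    have h2 : (Set.Icc b c ∩ Set.Icc 0 1 : Set ℝ) = Set.Icc b c :=
      Set.inter_eq_left.2 (Set.Icc_subset_Icc hb hc)
    exact ((ae_eq_refl _).inter h1).trans (by rw [h2]; exact Ioc_ae_eq_Icc.symm)
  rw [Measure.restrict_congr_set hae, ← ofReal_integral_eq_lintegral_ofReal,
    ← intervalIntegral.integral_of_le hbc]
  · congr 1
    have hd : ∀ x ∈ Set.uIcc b c, HasDerivAt (fun x => Real.log (1 + x) / Real.log 2)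
        (1 / (Real.log 2 * (1 + x))) x := by
      intro x hx
      rw [Set.uIcc_of_le hbc] at hx
      have hx1 : 1 + x ≠ 0 := by linarith [hx.1]
      have := (((hasDerivAt_id x).const_add 1).log hx1).div_const (Real.log 2)
      exact this.congr_deriv (by rw [div_div, mul_comm]; rfl)
    rw [intervalIntegral.integral_eq_sub_of_hasDerivAt hd]
    · ring
    · rw [intervalIntegrable_iff_integrableOn_Icc_of_le hbc]
      exact hcont.integrableOn_Icc
  · exact hcont.integrableOn_Icc.mono_set Set.Ioc_subset_Icc_self
  · filter_upwards [ae_restrict_mem measurableSet_Ioc] with x hx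
    have : 0 < 1 + x := by linarith [hx.1]
    positivity

theorem gaussMeasure_compl_Icc : gaussMeasure (Set.Icc (0 : ℝ) 1)ᶜ = 0 := by
  refine gaussMeasure_absolutelyContinuous ?_
  rw [Measure.restrict_apply measurableSet_Icc.compl]
  convert measure_empty (μ := (volume : Measure ℝ))
  exact Set.eq_empty_iff_forall_notMem.2 fun x hx => hx.1 ⟨hx.2.1, hx.2.2.le⟩

instance isProbabilityMeasure_gaussMeasure : IsProbabilityMeasure gaussMeasure := ⟨by
  have h := gaussMeasure_Icc le_rfl zero_le_one le_rfl
  have hl : 0 < Real.log 2 := Real.log_pos (by norm_num)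
  rw [show (1 : ℝ) + 1 = 2 by norm_num, add_zero, Real.log_one, sub_zero, div_self hl.ne',
    ENNReal.ofReal_one] at h
  rw [← h, measure_congr]
  exact ae_eq_univ.2 gaussMeasure_compl_Icc |>.symm⟩

theorem CFInfinite.gauss_le_iff {x : ℝ} (hx : CFInfinite x) {a : ℝ} (ha0 : 0 ≤ a) (ha : a < 1) :
    gauss x ≤ a ↔ ∃ n : ℕ, x ∈ Set.Icc (n + 1 + a)⁻¹ ((n : ℝ) + 1)⁻¹ := by
  have hx0 : 0 < x := (hx 0).1
  have hinv : x⁻¹ = cfDigit x 0 + gauss x := inv_gauss_iterate x 0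
  constructor
  · intro h
    obtain ⟨n, hn⟩ : ∃ n : ℕ, cfDigit x 0 = n + 1 :=
      ⟨(cfDigit x 0 - 1).toNat, by have := hx.one_le_cfDigit 0; omega⟩
    rw [hn] at hinv
    push_cast at hinv
    have h1 : 0 < gauss x := (hx 1).1
    refine ⟨n, (inv_le_comm₀ hx0 (by positivity)).1 (by linarith),
      (le_inv_comm₀ (by positivity) hx0).1 (by linarith)⟩
  · rintro ⟨n, h1, h2⟩
    have h2' : (n : ℝ) + 1 ≤ x⁻¹ := (le_inv_comm₀ (by positivity) hx0).2 h2
    have h1' : x⁻¹ ≤ n + 1 + a := (inv_le_comm₀ hx0 (by positivity)).2 h1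
    have : x⁻¹ = ((n + 1 : ℤ) : ℝ) + (x⁻¹ - (n + 1)) := by push_cast; ring
    rw [gauss_eq_fract, this, Int.fract_intCast_add,
      Int.fract_eq_self.2 ⟨by linarith, by linarith⟩]
    linarith

theorem hasSum_log_telescope {a : ℝ} (ha : 0 ≤ a) :
    HasSum (fun n : ℕ => (Real.log (1 + ((n : ℝ) + 1)⁻¹) - Real.log (1 + (n + 1 + a)⁻¹)) /
      Real.log 2) (Real.log (1 + a) / Real.log 2) := by
  refine HasSum.div_const ?_ _
  have hpos : ∀ n : ℕ, (0 : ℝ) < n + 1 := fun n => by positivity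
  rw [hasSum_iff_tendsto_nat_of_nonneg]
  · have hsum : ∀ N : ℕ, ∑ n ∈ Finset.range N,
        (Real.log (1 + ((n : ℝ) + 1)⁻¹) - Real.log (1 + (n + 1 + a)⁻¹)) =
        Real.log ((N + 1) / (N + 1 + a)) + Real.log (1 + a) := by
      intro N
      induction N with
      | zero => simp
      | succ N ih =>
        have h1 := hpos N
        have h2 : 0 < (N : ℝ) + 1 + a := by linarith
        have e1 : 1 + ((N : ℝ) + 1)⁻¹ = (N + 1 + 1) / (N + 1) := by field_simp
        have e2 : 1 + ((N : ℝ) + 1 + a)⁻¹ = (N + 1 + 1 + a) / (N + 1 + a) := by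
          field_simp; ring
        rw [Finset.sum_range_succ, ih, e1, e2]
        push_cast
        rw [Real.log_div, Real.log_div, Real.log_div, Real.log_div]
        · ring
        all_goals positivity
    simp_rw [hsum]
    have hlim : Tendsto (fun N : ℕ => ((N : ℝ) + 1) / (N + 1 + a)) atTop (nhds 1) := by
      have : Tendsto (fun N : ℕ => 1 - a / ((N : ℝ) + 1 + a)) atTop (nhds (1 - 0)) := by
        refine tendsto_const_nhds.sub (Tendsto.div_atTop tendsto_const_nhds ?_)
        refine tendsto_atTop_add_const_right _ _ (tendsto_atTop_add_const_right _ _ ?_)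
        exact tendsto_natCast_atTop_atTop
      rw [sub_zero] at this
      refine this.congr fun N => ?_
      have h2 : 0 < (N : ℝ) + 1 + a := by linarith [hpos N]
      field_simp
      ring
    have := (hlim.log one_ne_zero).add_const (Real.log (1 + a))
    rwa [Real.log_one, zero_add] at this
  · intro n
    have h1 := hpos n
    rw [sub_nonneg]
    refine Real.log_le_log (by positivity) ?_
    exact add_le_add_right (inv_anti₀ (by positivity) (by linarith)) 1

theorem gaussMeasure_Iio_zero : gaussMeasure (Set.Iio 0) = 0 :=
  measure_mono_null
    (fun _ hx => Set.mem_compl fun h => not_le.2 (Set.mem_Iio.1 hx) h.1) gaussMeasure_compl_Icc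

theorem gaussMeasure_Iic {a : ℝ} (ha : 0 ≤ a) (ha1 : a ≤ 1) :
    gaussMeasure (Set.Iic a) = ENNReal.ofReal (Real.log (1 + a) / Real.log 2) := by
  have h := gaussMeasure_Icc le_rfl ha ha1
  rw [add_zero, Real.log_one, sub_zero] at h
  rw [← h, ← Set.Iio_union_Icc_eq_Iic ha]
  exact measure_congr (union_ae_eq_right_of_ae_eq_empty (ae_eq_empty.2 gaussMeasure_Iio_zero))

theorem gaussMeasure_preimage_Iic {a : ℝ} (ha : 0 ≤ a) (ha1 : a < 1) :
    gaussMeasure (gauss ⁻¹' Set.Iic a) =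
      ENNReal.ofReal (Real.log (1 + a) / Real.log 2) := by
  have hae : (gauss ⁻¹' Set.Iic a : Set ℝ) =ᵐ[gaussMeasure]
      ⋃ n : ℕ, Set.Icc (n + 1 + a)⁻¹ ((n : ℝ) + 1)⁻¹ := by
    refine eventuallyEq_set.2 ?_
    filter_upwards [ae_gaussMeasure_cfInfinite] with x hx
    rw [Set.mem_preimage, Set.mem_Iic, hx.gauss_le_iff ha ha1, Set.mem_iUnion]
  have hdisj : Pairwise (Function.onFun Disjoint fun n : ℕ =>
      Set.Icc ((n : ℝ) + 1 + a)⁻¹ ((n : ℝ) + 1)⁻¹) := by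
    rw [(symm_disjoint.comap _).pairwise_on]
    intro n m hnm
    refine Set.disjoint_left.2 fun x hx hx' => ?_
    have h1 := hx.1.trans hx'.2
    have h2 : (n : ℝ) + 1 ≤ m := by exact_mod_cast hnm
    rw [inv_le_inv₀ (by positivity) (by positivity)] at h1
    linarith
  rw [measure_congr hae, measure_iUnion hdisj fun _ => measurableSet_Icc]
  have hs := hasSum_log_telescope ha
  rw [← hs.tsum_eq, ENNReal.ofReal_tsum_of_nonneg _ hs.summable]
  · refine tsum_congr fun n => gaussMeasure_Icc (by positivity) ?_ ?_
    · exact inv_anti₀ (by positivity) (by linarith)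
    · exact inv_le_one_of_one_le₀ (by linarith [(n.cast_nonneg : (0 : ℝ) ≤ n)])
  · intro n
    refine div_nonneg ?_ (Real.log_nonneg one_le_two)
    rw [sub_nonneg]
    refine Real.log_le_log (by positivity) ?_
    exact add_le_add_right (inv_anti₀ (by positivity) (by linarith)) 1

/-- The Gauss map preserves the Gauss measure. -/
theorem measurePreserving_gauss : MeasurePreserving gauss gaussMeasure gaussMeasure := by
  refine ⟨measurable_gauss, ?_⟩
  have : IsFiniteMeasure (gaussMeasure.map gauss) :=
    Measure.isFiniteMeasure_map gaussMeasure gauss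
  refine Measure.ext_of_Iic _ _ fun a => ?_
  rw [Measure.map_apply measurable_gauss measurableSet_Iic]
  rcases lt_or_ge a 0 with h0 | h0
  · have : gauss ⁻¹' Set.Iic a = ∅ := Set.eq_empty_iff_forall_notMem.2 fun x hx =>
      not_le.2 h0 ((gauss_mem_Ico x).1.trans hx)
    rw [this, measure_empty]
    exact (measure_mono_null (Set.Iic_subset_Iio.2 h0) gaussMeasure_Iio_zero).symm
  rcases lt_or_ge a 1 with h1 | h1
  · rw [gaussMeasure_preimage_Iic h0 h1, gaussMeasure_Iic h0 h1.le]
  · have e : gauss ⁻¹' Set.Iic a = Set.univ :=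
      Set.eq_univ_of_forall fun x => (gauss_mem_Ico x).2.le.trans h1
    rw [e, measure_univ, eq_comm, ← prob_compl_eq_zero_iff measurableSet_Iic]
    exact measure_mono_null (Set.compl_subset_compl.2 fun x hx => hx.2.trans h1)
      gaussMeasure_compl_Icc

/-! ### Ergodicity of the Gauss map -/

theorem volume_le_of_relation {A B : Set ℝ} {R : ℝ → ℝ → Prop} {K : ℝ≥0}
    (h : ∀ a ∈ A, ∃ b ∈ B, R a b)
    (hR : ∀ a ∈ A, ∀ a' ∈ A, ∀ b ∈ B, ∀ b' ∈ B, R a b → R a' b' → |a - a'| ≤ K * |b - b'|) :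
    volume A ≤ K * volume B := by
  classical
  set B' : Set ℝ := {b | b ∈ B ∧ ∃ a ∈ A, R a b} with hB'
  have hch : ∀ b : ℝ, ∃ a, b ∈ B' → a ∈ A ∧ R a b := fun b => by
    by_cases hb : b ∈ B'
    · obtain ⟨a, ha⟩ := hb.2
      exact ⟨a, fun _ => ha⟩
    · exact ⟨0, fun h => absurd h hb⟩
  choose g hg using hch
  have hlip : LipschitzOnWith K g B' := by
    refine LipschitzOnWith.of_dist_le_mul fun b hb b' hb' => ?_
    rw [Real.dist_eq, Real.dist_eq]
    exact hR _ (hg b hb).1 _ (hg b' hb').1 _ hb.1 _ hb'.1 (hg b hb).2 (hg b' hb').2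
  have hsub : A ⊆ g '' B' := by
    intro a ha
    obtain ⟨b, hb, hab⟩ := h a ha
    have hbB : b ∈ B' := ⟨hb, a, ha, hab⟩
    refine ⟨b, hbB, ?_⟩
    have := hR _ (hg b hbB).1 _ ha _ hb _ hb (hg b hbB).2 hab
    rw [sub_self, abs_zero, mul_zero] at this
    exact sub_eq_zero.1 (abs_eq_zero.1 (le_antisymm this (abs_nonneg _)))
  have := hlip.hausdorffMeasure_image_le (d := 1) zero_le_one
  rw [hausdorffMeasure_real, ENNReal.rpow_one] at this
  exact (measure_mono hsub).trans (this.trans (mul_le_mul_right (measure_mono fun b hb => hb.1) _))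

theorem restrict_le_volume_infinite (A : Set ℝ) :
    volume.restrict (Set.Ico (0 : ℝ) 1) A ≤ volume {x | x ∈ A ∧ CFInfinite x} := by
  refine le_trans (measure_mono_ae ?_) (Measure.restrict_apply_le (Set.Ico (0 : ℝ) 1) _)
  filter_upwards [ae_cfInfinite] with x hx hA
  exact ⟨hA, hx⟩

theorem iterate_mem_iff_of_preimage_eq {α : Type*} {f : α → α} {B : Set α} (hB : f ⁻¹' B = B)
    (k : ℕ) (t : α) : f^[k] t ∈ B ↔ t ∈ B := by
  induction k with
  | zero => rfl
  | succ k ih =>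
    rw [Function.iterate_succ_apply', ← ih]
    exact Set.ext_iff.1 hB _

/-- Invariant sets are quasi-independent of cylinders. -/
theorem restrict_mul_restrict_cyl_le {B : Set ℝ} (hB : gauss ⁻¹' B = B) {s : List ℤ}
    (hs : ∀ c ∈ s, 0 < c) {t : ℝ} (ht : CFInfinite t) (hts : t ∈ cyl s) :
    volume.restrict (Set.Ico (0 : ℝ) 1) B * volume.restrict (Set.Ico (0 : ℝ) 1) (cyl s) ≤
      16 * volume.restrict (Set.Ico (0 : ℝ) 1) (B ∩ cyl s) := by
  set k := s.length with hk
  set θ := gaussProd t k with hθ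
  have hθ0 : 0 < θ := ht.gaussProd_pos k
  have hdig : ∀ z ∈ cyl s, ∀ w ∈ cyl s, ∀ i < k, cfDigit z i = cfDigit w i :=
    fun z hz w hw i hi => by rw [hz.2 i hi, hw.2 i hi]
  have h1 : volume.restrict (Set.Ico (0 : ℝ) 1) (cyl s) ≤ ENNReal.ofReal (4 * θ ^ 2) := by
    refine (restrict_le_volume_infinite _).trans ?_
    have : {x | x ∈ cyl s ∧ CFInfinite x} ⊆ Set.Icc (t - 2 * θ ^ 2) (t + 2 * θ ^ 2) := by
      rintro z ⟨hzs, hz⟩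
      have e1 := hz.abs_sub_eq ht (hdig t hts z hzs)
      have e2 := hz.gaussProd_le_two_mul ht (hdig t hts z hzs)
      have e3 : |gauss^[k] z - gauss^[k] t| ≤ 1 :=
        abs_le.2 ⟨by linarith [(hz k).1, (ht k).2], by linarith [(hz k).2, (ht k).1]⟩
      have e4 : |z - t| ≤ 2 * θ ^ 2 := by
        rw [e1]
        have := hz.gaussProd_pos k
        calc gaussProd z k * θ * |gauss^[k] z - gauss^[k] t| ≤ (2 * θ) * θ * 1 := by gcongr
          _ = 2 * θ ^ 2 := by ring
      rw [abs_le] at e4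
      exact ⟨by linarith, by linarith⟩
    refine (measure_mono this).trans ?_
    rw [Real.volume_Icc]
    exact ENNReal.ofReal_le_ofReal (by linarith)
  have h2 : volume.restrict (Set.Ico (0 : ℝ) 1) B ≤
      ENNReal.ofReal (4 / θ ^ 2) * volume.restrict (Set.Ico (0 : ℝ) 1) (B ∩ cyl s) := by
    refine (restrict_le_volume_infinite _).trans ?_
    have hcyl : volume {x | (x ∈ B ∧ x ∈ cyl s) ∧ CFInfinite x} ≤
        volume.restrict (Set.Ico (0 : ℝ) 1) (B ∩ cyl s) := by
      have := Measure.le_restrict_apply (μ := (volume : Measure ℝ)) (Set.Ico (0 : ℝ) 1)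
        (B ∩ cyl s)
      refine le_trans (measure_mono ?_) this
      rintro x ⟨⟨h1, h2⟩, -⟩
      exact ⟨⟨h1, h2⟩, h2.1⟩
    refine le_trans (volume_le_of_relation (R := fun a b => gauss^[k] b = a)
      (B := {x | (x ∈ B ∧ x ∈ cyl s) ∧ CFInfinite x}) (K := (4 / θ ^ 2).toNNReal) ?_ ?_)
      (mul_le_mul_right hcyl _)
    · rintro a ⟨haB, ha⟩
      obtain ⟨b, hb, hbs, hba⟩ := exists_mem_cyl_gauss_iterate_eq hs ha
      refine ⟨b, ⟨⟨?_, hbs⟩, hb⟩, hba⟩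
      rw [← iterate_mem_iff_of_preimage_eq hB k, hba]
      exact haB
    · rintro a - a' - b ⟨⟨-, hbs⟩, hb⟩ b' ⟨⟨-, hbs'⟩, hb'⟩ rfl rfl
      rw [Real.coe_toNNReal _ (by positivity), hb.abs_sub_eq hb' (hdig b' hbs' b hbs)]
      have e1 := ht.gaussProd_le_two_mul hb (hdig b hbs t hts)
      have e2 := ht.gaussProd_le_two_mul hb' (hdig b' hbs' t hts)
      have e3 : θ ^ 2 ≤ 4 * (gaussProd b k * gaussProd b' k) := by nlinarith
      rw [← mul_assoc]
      refine le_mul_of_one_le_left (abs_nonneg _) ?_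
      rw [div_mul_eq_mul_div, le_div_iff₀ (by positivity)]
      linarith
  calc _ ≤ (ENNReal.ofReal (4 / θ ^ 2) * volume.restrict (Set.Ico (0 : ℝ) 1) (B ∩ cyl s)) *
        ENNReal.ofReal (4 * θ ^ 2) := mul_le_mul' h2 h1
    _ = (ENNReal.ofReal (4 / θ ^ 2) * ENNReal.ofReal (4 * θ ^ 2)) *
        volume.restrict (Set.Ico (0 : ℝ) 1) (B ∩ cyl s) := by ring
    _ = _ := by
      rw [← ENNReal.ofReal_mul (by positivity)]
      congr 1
      rw [show 4 / θ ^ 2 * (4 * θ ^ 2) = 16 by field_simp; norm_num]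
      simp

theorem restrict_mul_restrict_isOpen_le {B U : Set ℝ} (hBm : MeasurableSet B)
    (hB : gauss ⁻¹' B = B) (hU : IsOpen U) :
    volume.restrict (Set.Ico (0 : ℝ) 1) B * volume.restrict (Set.Ico (0 : ℝ) 1) U ≤
      16 * volume.restrict (Set.Ico (0 : ℝ) 1) (B ∩ U) := by
  obtain ⟨S, hS, hSt, hd, hcov⟩ := exists_disjoint_cyl_cover hU
  set ν := volume.restrict (Set.Ico (0 : ℝ) 1)
  have hae : U =ᵐ[ν] ⋃ s ∈ S, cyl s := by
    refine eventuallyEq_set.2 ?_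
    filter_upwards [ae_cfInfinite] with z hz
    rw [← hcov z hz]
    simp
  have hBU : ν (B ∩ U) = ∑' s : S, ν (B ∩ cyl s) := by
    rw [measure_congr ((ae_eq_refl B).inter hae), Set.inter_iUnion₂,
      measure_biUnion S.to_countable
        (fun s hs s' hs' hne => (hd hs hs' hne).mono Set.inter_subset_right Set.inter_subset_right)
        fun s _ => hBm.inter (measurableSet_cyl s)]
  rw [hBU, measure_congr hae, measure_biUnion S.to_countable hd fun s _ => measurableSet_cyl s,
    ← ENNReal.tsum_mul_left, ← ENNReal.tsum_mul_left]
  refine ENNReal.tsum_le_tsum fun s => ?_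
  obtain ⟨t, ht, hts⟩ := hSt s s.2
  exact restrict_mul_restrict_cyl_le hB (hS s s.2).2 ht hts

/-- The Gauss map is ergodic. -/
theorem ergodic_gauss : Ergodic gauss gaussMeasure := by
  refine ⟨measurePreserving_gauss, ⟨fun B hBm hB => ?_⟩⟩
  set ν := volume.restrict (Set.Ico (0 : ℝ) 1) with hν
  have hfin : ∀ A, ν A ≠ ⊤ := fun A => measure_ne_top ν A
  have key : ν B * ν Bᶜ = 0 := by
    refine le_antisymm (ENNReal.le_of_forall_pos_le_add fun ε hε _ => ?_) zero_le
    obtain ⟨U, hBU, hU, hlt⟩ := Bᶜ.exists_isOpen_lt_add (hfin Bᶜ)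
      (show (ε / 16 : ℝ≥0∞) ≠ 0 by simp [hε.ne'])
    have hsplit : ν (B ∩ U) + ν Bᶜ ≤ ε / 16 + ν Bᶜ := by
      have h2 := measure_inter_add_sdiff (μ := ν) U hBm
      have h3 : ν Bᶜ ≤ ν (U \ B) := measure_mono fun x hx => ⟨hBU hx, hx⟩
      rw [Set.inter_comm] at h2
      calc _ ≤ ν (B ∩ U) + ν (U \ B) := by gcongr
        _ = ν U := h2
        _ ≤ _ := by rw [add_comm]; exact hlt.le
    have hsmall : ν (B ∩ U) ≤ ε / 16 := (ENNReal.add_le_add_iff_right (hfin _)).1 hsplit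
    calc ν B * ν Bᶜ ≤ ν B * ν U := by gcongr
      _ ≤ 16 * ν (B ∩ U) := restrict_mul_restrict_isOpen_le hBm hB hU
      _ ≤ 16 * (ε / 16) := by gcongr
      _ ≤ 0 + ε := by
        rw [zero_add, ENNReal.mul_div_cancel (by norm_num) (by norm_num)]
  rw [eventuallyConst_set']
  rcases mul_eq_zero.1 key with h | h
  · exact Or.inl (ae_eq_empty.2 (gaussMeasure_absolutelyContinuous h))
  · exact Or.inr (ae_eq_univ.2 (gaussMeasure_absolutelyContinuous h))

/-! ### Visits of normal orbits to closed sets -/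

theorem sum_cfCount_le {x : ℝ} {A : Set ℝ} {T : Finset (List ℤ)}
    (hd : (T : Set (List ℤ)).PairwiseDisjoint cyl)
    (hT : ∀ s ∈ T, ∀ k, gauss^[k] x ∈ cyl s → gauss^[k] x ∉ A) (N : ℕ)
    [DecidablePred fun k => gauss^[k] x ∈ A] :
    ∑ s ∈ T, cfCount x s N + ((Finset.range N).filter fun k => gauss^[k] x ∈ A).card ≤ N := by
  classical
  have h1 : ∑ s ∈ T, cfCount x s N =
      (T.biUnion fun s => (Finset.range N).filter fun k => gauss^[k] x ∈ cyl s).card := by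
    rw [Finset.card_biUnion]
    · refine Finset.sum_congr rfl fun s _ => ?_
      rw [cfCount]
    · intro s hs s' hs' hne
      refine Finset.disjoint_left.2 fun k hk hk' => ?_
      exact Set.disjoint_left.1 (hd hs hs' hne) (Finset.mem_filter.1 hk).2
        (Finset.mem_filter.1 hk').2
  rw [h1, ← Finset.card_union_of_disjoint]
  · refine (Finset.card_le_card ?_).trans (Finset.card_range N).le
    intro k hk
    simp only [Finset.mem_union, Finset.mem_biUnion, Finset.mem_filter] at hk
    rcases hk with ⟨s, -, hk, -⟩ | ⟨hk, -⟩ <;> exact hk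
  · refine Finset.disjoint_left.2 fun k hk hk' => ?_
    simp only [Finset.mem_biUnion, Finset.mem_filter] at hk hk'
    obtain ⟨s, hs, -, hks⟩ := hk
    exact hT s hs k hks hk'.2

open scoped Classical in
theorem cfNormal.eventually_card_le {x : ℝ} (hx : cfNormal x) (hi : CFInfinite x) {A : Set ℝ}
    (hA : IsClosed A) {ε : ℝ} (hε : 0 < ε) :
    ∀ᶠ N : ℕ in atTop, (((Finset.range N).filter fun k => gauss^[k] x ∈ A).card : ℝ) ≤
      (gaussMeasure.real A + ε) * N := by
  obtain ⟨S, hS, -, hd, hcov⟩ := exists_disjoint_cyl_cover hA.isOpen_compl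
  have hae : (Aᶜ : Set ℝ) =ᵐ[gaussMeasure] ⋃ s ∈ S, cyl s := by
    refine eventuallyEq_set.2 ?_
    filter_upwards [ae_gaussMeasure_cfInfinite] with z hz
    rw [← hcov z hz]
    simp
  have hsum : gaussMeasure Aᶜ = ∑' s : S, gaussMeasure (cyl s) := by
    rw [measure_congr hae,
      measure_biUnion S.to_countable hd fun s _ => measurableSet_cyl s]
  have hsum' : HasSum (fun s : S => gaussMeasure.real (cyl s)) (gaussMeasure.real Aᶜ) := by
    have hne : ∑' s : S, gaussMeasure (cyl s) ≠ ⊤ := hsum ▸ measure_ne_top _ _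
    have := ENNReal.hasSum_toReal hne
    rwa [← ENNReal.tsum_toReal_eq fun s => measure_ne_top _ _, ← hsum] at this
  obtain ⟨T, hT⟩ := (hsum'.eventually (lt_mem_nhds (sub_lt_self _ hε))).exists
  have hlim : Tendsto (fun n : ℕ => ∑ s ∈ T, (cfCount x s n : ℝ) / n) atTop
      (nhds (∑ s ∈ T, gaussMeasure.real (cyl s))) :=
    tendsto_finsetSum T fun s _ => hx.2 s (hS s s.2).1 (hS s s.2).2
  filter_upwards [hlim.eventually (lt_mem_nhds hT), eventually_ge_atTop 1] with N hN hN1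
  have hN0 : (0 : ℝ) < N := by exact_mod_cast hN1
  have hcount := sum_cfCount_le (x := x) (A := A) (T := T.map (Function.Embedding.subtype _))
    (hd.subset (by simp)) (by
      intro s hs k hk
      obtain ⟨s, -, rfl⟩ := Finset.mem_map.1 hs
      exact (hcov _ fun n => by rw [← Function.iterate_add_apply]; exact hi _).1 ⟨s, s.2, hk⟩) N
  rw [Finset.sum_map] at hcount
  rw [← Finset.sum_div, lt_div_iff₀ hN0, probReal_compl_eq_one_sub hA.measurableSet] at hN
  have hc : (∑ s ∈ T, (cfCount x s N : ℝ)) +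
      ((Finset.range N).filter fun k => gauss^[k] x ∈ A).card ≤ N := by exact_mod_cast hcount
  linarith

theorem gauss_zero : gauss 0 = 0 := if_pos rfl

theorem gaussMeasure_real_cyl_one_pos : 0 < gaussMeasure.real (cyl [1]) := by
  refine ENNReal.toReal_pos (ne_of_gt ?_) (measure_ne_top _ _)
  have : Set.Icc (2 / 3 : ℝ) (3 / 4) ⊆ cyl [1] := by
    rintro t ⟨h1, h2⟩
    refine ⟨⟨by linarith, by linarith⟩, fun i hi => ?_⟩
    obtain rfl : i = 0 := by simpa using hi
    have ht : 0 < t := by linarith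
    simp only [cfDigit, Function.iterate_zero, id_eq, List.getD_cons_zero]
    rw [Int.floor_eq_iff]
    constructor
    · push_cast
      rw [le_inv_comm₀ one_pos ht]; linarith
    · push_cast
      rw [inv_lt_comm₀ ht (by norm_num)]; norm_num; linarith
  refine lt_of_lt_of_le ?_ (measure_mono this)
  rw [gaussMeasure_Icc (by norm_num) (by norm_num) (by norm_num), ENNReal.ofReal_pos]
  exact div_pos (sub_pos.2 (Real.log_lt_log (by norm_num) (by norm_num)))
    (Real.log_pos (by norm_num))

theorem cfNormal.cfInfinite {x : ℝ} (hx : cfNormal x) : CFInfinite x := by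
  intro n
  have hI := gauss_iterate_mem_Ico hx.1 n
  refine ⟨lt_of_le_of_ne hI.1 fun h0 => ?_, hI.2⟩
  have hz : ∀ k, n ≤ k → gauss^[k] x = 0 := by
    intro k hk
    obtain ⟨m, rfl⟩ := Nat.exists_eq_add_of_le' hk
    rw [Function.iterate_add_apply, ← h0]
    exact Function.iterate_fixed gauss_zero m
  have hb : ∀ N, (cfCount x [1] N : ℝ) ≤ n := by
    classical
    intro N
    rw [cfCount]
    refine Nat.cast_le.2 ((Finset.card_le_card ?_).trans (Finset.card_range n).le)
    intro k hk
    rw [Finset.mem_filter] at hk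
    by_contra hkn
    have := hk.2.2 0 (by simp)
    rw [hz k (by simpa using hkn)] at this
    simp [cfDigit] at this
  have h1 := hx.2 [1] (by simp) (by simp)
  have h2 : Tendsto (fun N : ℕ => (cfCount x [1] N : ℝ) / N) atTop (nhds 0) :=
    squeeze_zero (fun N => by positivity) (fun N => div_le_div_of_nonneg_right (hb N) N.cast_nonneg)
      (tendsto_const_div_atTop_nhds_zero_nat (n : ℝ))
  exact gaussMeasure_real_cyl_one_pos.ne' (tendsto_nhds_unique h1 h2)

/-! ### The image of a compact set under a bilinear relation -/

/-- The points of `[0, 1]` related by `g` to a point of `E`. -/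
def bilinPreimage (g : ℤ × ℤ × ℤ × ℤ) (E : Set ℝ) : Set ℝ :=
  {t | t ∈ Set.Icc (0 : ℝ) 1 ∧ ∃ u ∈ E, bilinRel g t u}

theorem isCompact_bilinPreimage (g : ℤ × ℤ × ℤ × ℤ) {E : Set ℝ} (hE : IsCompact E) :
    IsCompact (bilinPreimage g E) := by
  have h : bilinPreimage g E =
      Prod.fst '' ((Set.Icc (0 : ℝ) 1 ×ˢ E) ∩ {p : ℝ × ℝ | bilinRel g p.1 p.2}) := by
    ext t
    constructor
    · rintro ⟨ht, u, hu, h⟩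
      exact ⟨(t, u), ⟨⟨ht, hu⟩, h⟩, rfl⟩
    · rintro ⟨⟨t, u⟩, ⟨⟨ht, hu⟩, h⟩, rfl⟩
      exact ⟨ht, u, hu, h⟩
  rw [h]
  refine ((isCompact_Icc.prod hE).inter_right ?_).image continuous_fst
  unfold bilinRel
  exact isClosed_eq (by fun_prop) continuous_const

theorem volume_bilinPreimage_le {g : ℤ × ℤ × ℤ × ℤ} (hg : g.1 * g.2.2.2 - g.2.1 * g.2.2.1 ≠ 0)
    (E : Set ℝ) :
    volume (bilinPreimage g E) ≤ ((|g.2.2.1| + |g.2.2.2| : ℝ) ^ 2).toNNReal * volume E := by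
  refine volume_le_of_relation (R := bilinRel g) (fun t ht => ht.2) ?_
  rintro t ⟨ht, -⟩ t' ⟨ht', -⟩ u - u' - h h'
  obtain ⟨a, b, c, d⟩ := g
  simp only [bilinRel] at h h' hg ⊢
  rw [Real.coe_toNNReal _ (by positivity)]
  have hid : ((a * d - b * c : ℤ) : ℝ) * (t - t') = (u - u') * ((c + d * t) * (c + d * t')) := by
    push_cast
    linear_combination (-(c + d * t') : ℝ) * h + (c + d * t : ℝ) * h'
  have hone : (1 : ℝ) ≤ |((a * d - b * c : ℤ) : ℝ)| := by
    rw [← Int.cast_abs]; exact_mod_cast Int.one_le_abs hg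
  have hb : ∀ s ∈ Set.Icc (0 : ℝ) 1, |(c : ℝ) + d * s| ≤ |(c : ℝ)| + |(d : ℝ)| := by
    intro s hs
    refine (abs_add_le _ _).trans ?_
    rw [abs_mul, abs_of_nonneg hs.1]
    nlinarith [abs_nonneg (d : ℝ), hs.2]
  calc |t - t'| ≤ |((a * d - b * c : ℤ) : ℝ)| * |t - t'| :=
        le_mul_of_one_le_left (abs_nonneg _) hone
    _ = |u - u'| * (|(c : ℝ) + d * t| * |(c : ℝ) + d * t'|) := by
        rw [← abs_mul, hid, abs_mul, abs_mul]
    _ ≤ |u - u'| * ((|(c : ℝ)| + |(d : ℝ)|) * (|(c : ℝ)| + |(d : ℝ)|)) := by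
        gcongr
        exacts [hb t ht, hb t' ht']
    _ = _ := by push_cast; ring

theorem exists_gaussMeasure_bilinPreimage_le {g : ℤ × ℤ × ℤ × ℤ}
    (hg : g.1 * g.2.2.2 - g.2.1 * g.2.2.1 ≠ 0) :
    ∃ K : ℝ, 0 ≤ K ∧ ∀ E ⊆ Set.Icc (0 : ℝ) 1,
      gaussMeasure.real (bilinPreimage g E) ≤ K * gaussMeasure.real E := by
  set C : ℝ≥0 := ((|g.2.2.1| + |g.2.2.2| : ℝ) ^ 2).toNNReal with hC
  refine ⟨4 * C, by positivity, fun E hE => ?_⟩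
  have hvol : volume E ≤ 2 * gaussMeasure E := by
    have h := restrict_le_gaussMeasure E
    rwa [restrict_Ico_eq_restrict_Icc, Measure.restrict_eq_self _ hE] at h
  have : gaussMeasure (bilinPreimage g E) ≤ (4 * C : ℝ≥0) * gaussMeasure E := by
    calc _ ≤ 2 * volume.restrict (Set.Ico (0 : ℝ) 1) (bilinPreimage g E) := gaussMeasure_le _
      _ ≤ 2 * volume (bilinPreimage g E) := by gcongr; exact Measure.restrict_le_self
      _ ≤ 2 * (C * (2 * gaussMeasure E)) := by
        gcongr
        exact (volume_bilinPreimage_le hg E).trans (by gcongr)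
      _ = _ := by push_cast; ring
  have h2 := ENNReal.toReal_mono (ENNReal.mul_ne_top ENNReal.coe_ne_top (measure_ne_top _ _)) this
  rw [ENNReal.toReal_mul] at h2
  simpa [Measure.real] using h2

open scoped Classical in
/-- Visits of the orbit of `y` to a compact set are controlled by its Gauss measure. -/
theorem cfNormal.exists_eventually_card_le {α β γ δ : ℤ} {x y ρ : ℝ} (hx : cfNormal x)
    (hy : CFInfinite y) (hD : α * δ - β * γ ≠ 0) (hρ : ρ ≠ 0) (h1 : α * x + β = ρ * y)
    (h2 : γ * x + δ = ρ) :
    ∃ K : ℝ, 0 ≤ K ∧ ∀ E ⊆ Set.Icc (0 : ℝ) 1, IsCompact E → ∀ ε : ℝ, 0 < ε →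
      ∀ᶠ N : ℕ in atTop, (((Finset.range N).filter fun n => gauss^[n] y ∈ E).card : ℝ) ≤
        (K * gaussMeasure.real E + ε) * N := by
  have hi := hx.cfInfinite
  obtain ⟨G, B, hG, hcard⟩ := exists_card_visits_le hi hy hD hρ h1 h2
  have hKg : ∀ g, ∃ K : ℝ, g ∈ G → 0 ≤ K ∧ ∀ E ⊆ Set.Icc (0 : ℝ) 1,
      gaussMeasure.real (bilinPreimage g E) ≤ K * gaussMeasure.real E := by
    intro g
    by_cases hg : g ∈ G
    · obtain ⟨K, hK⟩ := exists_gaussMeasure_bilinPreimage_le (hG g hg)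
      exact ⟨K, fun _ => hK⟩
    · exact ⟨0, fun h => absurd h hg⟩
  choose K hK using hKg
  have hK0 : 0 ≤ ∑ g ∈ G, K g := Finset.sum_nonneg fun g hg => (hK g hg).1
  refine ⟨2 * (B * B) * ∑ g ∈ G, K g, by positivity, fun E hE hEc ε hε => ?_⟩
  set η : ℝ := ε / (2 * (B * B) * G.card + 1) with hη
  have hη0 : 0 < η := by positivity
  rcases Nat.eq_zero_or_pos B with rfl | hB
  · filter_upwards with N
    have := hcard E N
    have h0 : ((Finset.range N).filter fun n => gauss^[n] y ∈ E).card = 0 := by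
      simpa using this
    rw [h0]
    simp only [CharP.cast_eq_zero]
    positivity
  have hev : ∀ᶠ M : ℕ in atTop, ∀ g ∈ G,
      (((Finset.range M).filter fun k => gauss^[k] x ∈ bilinPreimage g E).card : ℝ) ≤
        (gaussMeasure.real (bilinPreimage g E) + η) * M :=
    (Finset.eventually_all G).2 fun g _ =>
      hx.eventually_card_le hi (isCompact_bilinPreimage g hEc).isClosed hη0
  have htend : Tendsto (fun N : ℕ => B * (N + B)) atTop atTop :=
    tendsto_atTop_mono (fun N => (Nat.le_add_right N B).trans (Nat.le_mul_of_pos_left _ hB))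
      tendsto_id
  filter_upwards [htend.eventually hev, eventually_ge_atTop B] with N hN hNB
  have hNB' : (B : ℝ) ≤ N := by exact_mod_cast hNB
  have hμ : 0 ≤ gaussMeasure.real E := measureReal_nonneg
  have hterm : ∀ g ∈ G, (((Finset.range (B * (N + B))).filter fun k =>
      ∃ u ∈ E, bilinRel g (gauss^[k] x) u).card : ℝ) ≤
        (K g * gaussMeasure.real E + η) * (B * (2 * N)) := by
    intro g hg
    have hK1 := (hK g hg).1
    have heq : ((Finset.range (B * (N + B))).filter fun k =>
        ∃ u ∈ E, bilinRel g (gauss^[k] x) u) =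
        (Finset.range (B * (N + B))).filter fun k => gauss^[k] x ∈ bilinPreimage g E := by
      refine Finset.filter_congr fun k _ => ?_
      exact ⟨fun h => ⟨⟨(hi k).1.le, (hi k).2.le⟩, h⟩, fun h => h.2⟩
    rw [heq]
    refine (hN g hg).trans ?_
    have := (hK g hg).2 E hE
    push_cast
    gcongr
    linarith
  have hmain : (((Finset.range N).filter fun n => gauss^[n] y ∈ E).card : ℝ) ≤
      B * ∑ g ∈ G, (K g * gaussMeasure.real E + η) * (B * (2 * N)) := by
    calc _ ≤ ((B * ∑ g ∈ G, ((Finset.range (B * (N + B))).filter fun k =>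
          ∃ u ∈ E, bilinRel g (gauss^[k] x) u).card : ℕ) : ℝ) := by exact_mod_cast hcard E N
      _ ≤ _ := by
        push_cast
        gcongr with g hg
        exact hterm g hg
  refine hmain.trans ?_
  rw [← Finset.sum_mul, Finset.sum_add_distrib, ← Finset.sum_mul, Finset.sum_const, nsmul_eq_mul]
  have hηε : 2 * (B * B) * G.card * η ≤ ε := by
    rw [hη, mul_div_assoc', div_le_iff₀ (by positivity)]
    nlinarith
  have hN0 : (0 : ℝ) ≤ N := Nat.cast_nonneg N
  nlinarith [mul_le_mul_of_nonneg_right hηε hN0]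

/-! ### The mean ergodic theorem, in measure -/

theorem memLp_birkhoffSum {α : Type*} [MeasurableSpace α] {μ : Measure α} {T : α → α}
    (hT : MeasurePreserving T μ μ) {f : α → ℝ} {p : ℝ≥0∞} (hf : MemLp f p μ) (n : ℕ) :
    MemLp (birkhoffSum T f n) p μ := by
  have := memLp_finsetSum' (Finset.range n) fun k _ => hf.comp_measurePreserving (hT.iterate k)
  convert this using 1
  ext x
  simp [birkhoffSum]

theorem memLp_birkhoffAverage {α : Type*} [MeasurableSpace α] {μ : Measure α} {T : α → α}
    (hT : MeasurePreserving T μ μ) {f : α → ℝ} {p : ℝ≥0∞} (hf : MemLp f p μ) (n : ℕ) :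
    MemLp (birkhoffAverage ℝ T f n) p μ :=
  (memLp_birkhoffSum hT hf n).const_smul (n : ℝ)⁻¹

theorem birkhoffAverage_toLp {α : Type*} [MeasurableSpace α] {μ : Measure α} {T : α → α}
    (hT : MeasurePreserving T μ μ) {f : α → ℝ} {p : ℝ≥0∞} (hf : MemLp f p μ) (n : ℕ) :
    birkhoffAverage ℝ (Lp.compMeasurePreserving (E := ℝ) (p := p) T hT) id n (hf.toLp f) =
      (memLp_birkhoffAverage hT hf n).toLp _ := by
  have h : birkhoffSum (Lp.compMeasurePreserving (E := ℝ) (p := p) T hT) id n (hf.toLp f) =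
      (memLp_birkhoffSum hT hf n).toLp _ := by
    induction n with
    | zero => rfl
    | succ n ih =>
      rw [birkhoffSum_succ, ih, Lp.compMeasurePreserving_iterate, id_eq,
        Lp.toLp_compMeasurePreserving, ← MemLp.toLp_add]
      congr 1
      ext x
      simp [birkhoffSum_succ]
  rw [birkhoffAverage, h]
  rfl

theorem integral_birkhoffAverage {α : Type*} [MeasurableSpace α] {μ : Measure α} {T : α → α}
    (hT : MeasurePreserving T μ μ) {f : α → ℝ} (hf : Integrable f μ) {n : ℕ} (hn : n ≠ 0) :
    ∫ x, birkhoffAverage ℝ T f n x ∂μ = ∫ x, f x ∂μ := by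
  have h : ∀ k, ∫ x, f (T^[k] x) ∂μ = ∫ x, f x ∂μ := fun k => by
    have hk := hT.iterate k
    rw [← integral_map hk.measurable.aemeasurable (by rw [hk.map_eq]; exact hf.1), hk.map_eq]
  simp only [birkhoffAverage, birkhoffSum, smul_eq_mul]
  rw [integral_const_mul, integral_finsetSum (f := fun k x => f (T^[k] x)) _ fun k _ =>
    (hT.iterate k).integrable_comp_of_integrable hf]
  simp only [h, Finset.sum_const, Finset.card_range, nsmul_eq_mul]
  field_simp

theorem Ergodic.tendstoInMeasure_birkhoffAverage {α : Type*} [MeasurableSpace α] {μ : Measure α}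
    [IsProbabilityMeasure μ] {T : α → α} (hT : Ergodic T μ) {f : α → ℝ} (hf : MemLp f 2 μ) :
    TendstoInMeasure μ (fun n => birkhoffAverage ℝ T f n) atTop fun _ => ∫ x, f x ∂μ := by
  have hmp := hT.toMeasurePreserving
  set U := (Lp.compMeasurePreservingₗᵢ ℝ (E := ℝ) (p := 2) T hmp).toContinuousLinearMap with hU
  have hlim := U.tendsto_birkhoffAverage_orthogonalProjection
    (LinearIsometry.norm_toContinuousLinearMap_le _) (hf.toLp f)
  set P := (U.eqLocus (1 : Lp ℝ 2 μ →L[ℝ] Lp ℝ 2 μ)).orthogonalProjectionOnto (hf.toLp f)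
  have hfix : Lp.compMeasurePreserving T hmp (P : Lp ℝ 2 μ) = P := P.2
  obtain ⟨c, hc⟩ := hT.ae_eq_const_of_ae_eq_comp_ae (Lp.aestronglyMeasurable (P : Lp ℝ 2 μ))
    ((Lp.coeFn_compMeasurePreserving _ hmp).symm.trans (by rw [hfix]))
  have hlim' : Tendsto (fun n => (memLp_birkhoffAverage hmp hf n).toLp _) atTop
      (nhds (P : Lp ℝ 2 μ)) := by
    refine hlim.congr fun n => ?_
    exact birkhoffAverage_toLp hmp hf n
  have hcf : c = ∫ x, f x ∂μ := by
    have h1 : Tendsto (fun n => ∫ x, (memLp_birkhoffAverage hmp hf n).toLp _ x ∂μ) atTop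
        (nhds (∫ x, (P : Lp ℝ 2 μ) x ∂μ)) := by
      have := (tendsto_const_nhds (x := indicatorConstLp 2 MeasurableSet.univ
        (measure_ne_top μ _) (1 : ℝ))).inner hlim' (𝕜 := ℝ)
      simpa only [L2.inner_indicatorConstLp_one, Measure.restrict_univ] using this
    have h2 : ∫ x, (P : Lp ℝ 2 μ) x ∂μ = c := by
      rw [integral_congr_ae hc]; simp
    rw [h2] at h1
    refine tendsto_nhds_unique h1 (tendsto_const_nhds.congr' ?_)
    filter_upwards [eventually_ne_atTop 0] with n hn
    rw [integral_congr_ae (MemLp.coeFn_toLp _),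
      integral_birkhoffAverage hmp (hf.integrable one_le_two) hn]
  have := tendstoInMeasure_of_tendsto_Lp hlim'
  refine this.congr (fun n => MemLp.coeFn_toLp _) ?_
  rw [← hcf]
  exact hc

/-! ### Normality from control of visits to compact sets -/

theorem CFInfinite.iterate {t : ℝ} (ht : CFInfinite t) (k : ℕ) : CFInfinite (gauss^[k] t) :=
  fun n => by rw [← Function.iterate_add_apply]; exact ht _

theorem CFInfinite.eventually_floor_inv_eq {t : ℝ} (ht : CFInfinite t) :
    ∀ᶠ z in nhds t, ⌊z⁻¹⌋ = ⌊t⁻¹⌋ := by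
  have ht0 : t ≠ 0 := (ht 0).1.ne'
  have h1 := ht 1
  rw [Function.iterate_one, gauss, if_neg ht0] at h1
  have hc : ContinuousAt (fun z : ℝ => z⁻¹) t := continuousAt_inv₀ ht0
  filter_upwards [hc.eventually (Ioo_mem_nhds (a := (⌊t⁻¹⌋ : ℝ)) (b := ⌊t⁻¹⌋ + 1)
    (by linarith [h1.1]) (by linarith [h1.2]))] with z hz
  exact Int.floor_eq_iff.2 ⟨hz.1.le, hz.2⟩

theorem CFInfinite.continuousAt_gauss {t : ℝ} (ht : CFInfinite t) : ContinuousAt gauss t := by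
  have ht0 : t ≠ 0 := (ht 0).1.ne'
  have hc : ContinuousAt (fun z : ℝ => z⁻¹ - ⌊t⁻¹⌋) t :=
    (continuousAt_inv₀ ht0).sub continuousAt_const
  refine hc.congr ?_
  filter_upwards [ht.eventually_floor_inv_eq, isOpen_ne.mem_nhds ht0] with z hz hz0
  rw [gauss, if_neg hz0, hz]

theorem CFInfinite.continuousAt_iterate {t : ℝ} (ht : CFInfinite t) (n : ℕ) :
    ContinuousAt gauss^[n] t := by
  induction n with
  | zero => exact continuousAt_id
  | succ n ih =>
    rw [Function.iterate_succ']
    exact (ht.iterate n).continuousAt_gauss.comp ih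

theorem CFInfinite.eventually_mem_cyl_iff {t : ℝ} (ht : CFInfinite t) (s : List ℤ) :
    ∀ᶠ z in nhds t, z ∈ cyl s ↔ t ∈ cyl s := by
  have h : ∀ᶠ z in nhds t, ∀ i ∈ Finset.range s.length, cfDigit z i = cfDigit t i :=
    (Finset.eventually_all _).2 fun i _ =>
      (ht.continuousAt_iterate i).eventually (ht.iterate i).eventually_floor_inv_eq
  have ht0 := ht 0
  filter_upwards [h, Ioo_mem_nhds ht0.1 ht0.2] with z hz hzI
  have hI : z ∈ Set.Ico (0 : ℝ) 1 ↔ t ∈ Set.Ico (0 : ℝ) 1 :=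
    iff_of_true ⟨hzI.1.le, hzI.2⟩ ⟨ht0.1.le, ht0.2⟩
  refine and_congr hI (forall₂_congr fun i hi => ?_)
  rw [hz i (Finset.mem_range.2 hi)]

/-- The indicator function of a cylinder. -/
noncomputable def cylInd (s : List ℤ) : ℝ → ℝ := (cyl s).indicator 1

theorem cylInd_nonneg (s : List ℤ) (t : ℝ) : 0 ≤ cylInd s t :=
  Set.indicator_nonneg (fun _ _ => zero_le_one) t

theorem cylInd_le_one (s : List ℤ) (t : ℝ) : cylInd s t ≤ 1 :=
  Set.indicator_le_self' (f := (1 : ℝ → ℝ)) (fun _ _ => zero_le_one) t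

theorem memLp_cylInd (s : List ℤ) : MemLp (cylInd s) 2 gaussMeasure :=
  memLp_indicator_const 2 (measurableSet_cyl s) 1 (Or.inr (measure_ne_top _ _))

theorem integral_cylInd (s : List ℤ) :
    ∫ t, cylInd s t ∂gaussMeasure = gaussMeasure.real (cyl s) :=
  integral_indicator_one (measurableSet_cyl s)

theorem birkhoffSum_cylInd (s : List ℤ) (n : ℕ) (x : ℝ) :
    birkhoffSum gauss (cylInd s) n x = cfCount x s n := by
  classical
  rw [birkhoffSum, cfCount, Finset.card_filter]
  push_cast
  refine Finset.sum_congr rfl fun k _ => ?_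
  by_cases h : gauss^[k] x ∈ cyl s <;> simp [cylInd, h]

theorem birkhoffAverage_cylInd_mem_Icc (s : List ℤ) (k : ℕ) (x : ℝ) :
    birkhoffAverage ℝ gauss (cylInd s) k x ∈ Set.Icc (0 : ℝ) 1 := by
  rw [birkhoffAverage, smul_eq_mul, inv_mul_eq_div]
  refine ⟨div_nonneg (Finset.sum_nonneg fun i _ => cylInd_nonneg s _) k.cast_nonneg,
    div_le_one_of_le₀ ?_ k.cast_nonneg⟩
  refine (Finset.sum_le_sum fun i _ => cylInd_le_one s _).trans ?_
  simp

theorem CFInfinite.eventually_birkhoffAverage_cylInd_eq {t : ℝ} (ht : CFInfinite t) (s : List ℤ)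
    (k : ℕ) : ∀ᶠ z in nhds t,
      birkhoffAverage ℝ gauss (cylInd s) k z = birkhoffAverage ℝ gauss (cylInd s) k t := by
  classical
  have h : ∀ᶠ z in nhds t, ∀ i ∈ Finset.range k,
      (gauss^[i] z ∈ cyl s ↔ gauss^[i] t ∈ cyl s) :=
    (Finset.eventually_all _).2 fun i _ =>
      (ht.continuousAt_iterate i).eventually ((ht.iterate i).eventually_mem_cyl_iff s)
  filter_upwards [h] with z hz
  rw [birkhoffAverage, birkhoffAverage, birkhoffSum, birkhoffSum]
  congr 1
  refine Finset.sum_congr rfl fun i hi => ?_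
  simp only [cylInd, Set.indicator_apply, hz i hi, Pi.one_apply]

/-- Off a compact set of small Gauss measure, Birkhoff averages of cylinder indicators are close
to the measure of the cylinder. -/
theorem exists_isCompact_birkhoffAverage_close (s : List ℤ) {ε δ : ℝ} (hε : 0 < ε) (hδ : 0 < δ) :
    ∃ k : ℕ, k ≠ 0 ∧ ∃ E ⊆ Set.Icc (0 : ℝ) 1, IsCompact E ∧ gaussMeasure.real E ≤ δ ∧
      ∀ t ∈ Set.Ico (0 : ℝ) 1, t ∉ E →
        |birkhoffAverage ℝ gauss (cylInd s) k t - gaussMeasure.real (cyl s)| < ε := by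
  have h := ergodic_gauss.tendstoInMeasure_birkhoffAverage (memLp_cylInd s)
  rw [integral_cylInd, tendstoInMeasure_iff_dist] at h
  have hδ' : (0 : ℝ≥0∞) < ENNReal.ofReal δ := ENNReal.ofReal_pos.2 hδ
  obtain ⟨k, hk, hk0⟩ :=
    (((h ε hε).eventually (gt_mem_nhds hδ')).and (eventually_ne_atTop 0)).exists
  set F := birkhoffAverage ℝ gauss (cylInd s) k with hF
  set p := gaussMeasure.real (cyl s)
  set E : Set ℝ := {t | t ∈ Set.Ico (0 : ℝ) 1 ∧ ε ≤ |F t - p|} with hE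
  have hEI : closure E ⊆ Set.Icc (0 : ℝ) 1 :=
    closure_minimal (fun t ht => ⟨ht.1.1, ht.1.2.le⟩) isClosed_Icc
  refine ⟨k, hk0, closure E, hEI, isCompact_Icc.of_isClosed_subset isClosed_closure hEI, ?_, ?_⟩
  · refine ENNReal.toReal_le_of_le_ofReal hδ.le (le_trans (measure_mono_ae ?_) hk.le)
    filter_upwards [ae_gaussMeasure_cfInfinite] with t ht htE
    obtain ⟨z, hz1, hz2⟩ := mem_closure_iff_frequently.1 htE |>.and_eventually
      (ht.eventually_birkhoffAverage_cylInd_eq s k) |>.exists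
    have := hz1.2
    rw [hF, hz2] at this
    exact this
  · intro t ht htE
    by_contra hcon
    exact htE (subset_closure ⟨ht, not_lt.1 hcon⟩)

theorem abs_birkhoffSum_iterate_sub_le {α : Type*} {T : α → α} {f : α → ℝ}
    (hf : ∀ a b, |f a - f b| ≤ 1) (N i : ℕ) (y : α) :
    |birkhoffSum T f N (T^[i] y) - birkhoffSum T f N y| ≤ i := by
  induction i with
  | zero => simp
  | succ i ih =>
    have h := dist_birkhoffSum_apply_birkhoffSum T f N (T^[i] y)
    rw [Real.dist_eq, Real.dist_eq] at h
    rw [Function.iterate_succ_apply']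
    have h2 := hf (T^[N] (T^[i] y)) (T^[i] y)
    have h3 := abs_sub_le (birkhoffSum T f N (T (T^[i] y))) (birkhoffSum T f N (T^[i] y))
      (birkhoffSum T f N y)
    push_cast
    linarith

theorem abs_sum_birkhoffAverage_sub_le {α : Type*} {T : α → α} {f : α → ℝ}
    (hf : ∀ a b, |f a - f b| ≤ 1) {k : ℕ} (hk : k ≠ 0) (N : ℕ) (y : α) :
    |∑ n ∈ Finset.range N, birkhoffAverage ℝ T f k (T^[n] y) - birkhoffSum T f N y| ≤ k := by
  have hk0 : (0 : ℝ) < k := by positivity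
  have h : ∑ n ∈ Finset.range N, birkhoffAverage ℝ T f k (T^[n] y) =
      (k : ℝ)⁻¹ * ∑ i ∈ Finset.range k, birkhoffSum T f N (T^[i] y) := by
    simp only [birkhoffAverage, birkhoffSum, smul_eq_mul, ← Finset.mul_sum]
    rw [Finset.sum_comm]
    simp only [← Function.iterate_add_apply, add_comm]
  have h2 : ∑ n ∈ Finset.range N, birkhoffAverage ℝ T f k (T^[n] y) - birkhoffSum T f N y =
      (k : ℝ)⁻¹ * ∑ i ∈ Finset.range k, (birkhoffSum T f N (T^[i] y) - birkhoffSum T f N y) := by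
    rw [h, Finset.sum_sub_distrib, Finset.sum_const, Finset.card_range, nsmul_eq_mul]
    field_simp
  rw [h2, abs_mul, abs_of_pos (inv_pos.2 hk0), inv_mul_le_iff₀ hk0]
  refine (Finset.abs_sum_le_sum_abs _ _).trans ?_
  have : ∀ i ∈ Finset.range k, |birkhoffSum T f N (T^[i] y) - birkhoffSum T f N y| ≤ k :=
    fun i hi => (abs_birkhoffSum_iterate_sub_le hf N i y).trans
      (by exact_mod_cast (Finset.mem_range.1 hi).le)
  refine (Finset.sum_le_sum this).trans ?_
  simp

open scoped Classical in
/-- If the visits of an orbit to compact sets are dominated by a multiple of the Gauss measure,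
then the orbit is normal. -/
theorem CFInfinite.cfNormal_of_eventually_card_le {y K : ℝ} (hy : CFInfinite y) (hK : 0 ≤ K)
    (h : ∀ E ⊆ Set.Icc (0 : ℝ) 1, IsCompact E → ∀ ε : ℝ, 0 < ε →
      ∀ᶠ N : ℕ in atTop, (((Finset.range N).filter fun n => gauss^[n] y ∈ E).card : ℝ) ≤
        (K * gaussMeasure.real E + ε) * N) : cfNormal y := by
  refine ⟨hy.mem_Ico, fun s _ _ => Metric.tendsto_atTop'.2 fun ε hε => ?_⟩
  set p := gaussMeasure.real (cyl s) with hp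
  have hp0 : 0 ≤ p := measureReal_nonneg
  have hp1 : p ≤ 1 := measureReal_le_one
  obtain ⟨k, hk, E, hE, hEc, hEδ, hclose⟩ := exists_isCompact_birkhoffAverage_close s
    (ε := ε / 4) (δ := ε / (4 * (K + 1))) (by positivity) (by positivity)
  have hKE : K * gaussMeasure.real E ≤ ε / 4 := by
    have : K * (ε / (4 * (K + 1))) ≤ ε / 4 := by
      rw [mul_div_assoc', div_le_div_iff₀ (by positivity) (by norm_num)]
      nlinarith
    exact (mul_le_mul_of_nonneg_left hEδ hK).trans this
  have hdiff : ∀ a b, |cylInd s a - cylInd s b| ≤ 1 := fun a b =>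
    abs_le.2 ⟨by linarith [cylInd_nonneg s a, cylInd_le_one s b],
      by linarith [cylInd_nonneg s b, cylInd_le_one s a]⟩
  have hev := (h E hE hEc (ε / 4) (by positivity)).and
    (tendsto_natCast_atTop_atTop.eventually_gt_atTop (4 * k / ε))
  obtain ⟨N₀, hN₀⟩ := eventually_atTop.1 hev
  refine ⟨N₀, fun N hN => ?_⟩
  obtain ⟨hcard, hNk⟩ := hN₀ N hN.le
  have hN0 : (0 : ℝ) < N := lt_of_le_of_lt (by positivity) hNk
  rw [div_lt_iff₀ hε] at hNk
  have h1 := abs_sum_birkhoffAverage_sub_le hdiff hk N y (T := gauss)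
  rw [birkhoffSum_cylInd] at h1
  have h2 : |∑ n ∈ Finset.range N, birkhoffAverage ℝ gauss (cylInd s) k (gauss^[n] y) - N * p| ≤
      N * (ε / 4) + ((Finset.range N).filter fun n => gauss^[n] y ∈ E).card := by
    have e1 : ∑ n ∈ Finset.range N, birkhoffAverage ℝ gauss (cylInd s) k (gauss^[n] y) - N * p =
        ∑ n ∈ Finset.range N, (birkhoffAverage ℝ gauss (cylInd s) k (gauss^[n] y) - p) := by
      simp [Finset.sum_sub_distrib]
    have e2 : N * (ε / 4) + (((Finset.range N).filter fun n => gauss^[n] y ∈ E).card : ℝ) =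
        ∑ n ∈ Finset.range N, (ε / 4 + if gauss^[n] y ∈ E then 1 else 0) := by
      rw [Finset.sum_add_distrib, Finset.card_filter]
      simp
    rw [e1, e2]
    refine (Finset.abs_sum_le_sum_abs _ _).trans (Finset.sum_le_sum fun n _ => ?_)
    split_ifs with hn
    · have := birkhoffAverage_cylInd_mem_Icc s k (gauss^[n] y)
      refine abs_le.2 ⟨by linarith [this.1], by linarith [this.2]⟩
    · rw [add_zero]
      exact (hclose _ (hy.iterate n).mem_Ico hn).le
  have h3 : |(cfCount y s N : ℝ) - N * p| < ε * N := by
    rw [abs_le] at h1 h2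
    rw [abs_lt]
    have : (K * gaussMeasure.real E + ε / 4) * N ≤ (ε / 4 + ε / 4) * N := by gcongr
    constructor <;> nlinarith
  rw [Real.dist_eq, show (gaussMeasure (cyl s)).toReal = p from rfl,
    show (cfCount y s N : ℝ) / N - p = (cfCount y s N - N * p) / N by field_simp,
    abs_div, abs_of_pos hN0, div_lt_iff₀ hN0]
  exact h3

/-! ### Möbius images -/

theorem cfNormal.of_mobius_eq {α β γ δ : ℤ} {x y ρ : ℝ} (hx : cfNormal x)
    (hy : y ∈ Set.Ico (0 : ℝ) 1) (hD : α * δ - β * γ ≠ 0) (hρ : ρ ≠ 0) (h1 : α * x + β = ρ * y)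
    (h2 : γ * x + δ = ρ) : cfNormal y := by
  have hxi : Irrational x := hx.cfInfinite.irrational
  have hyi : Irrational y := by
    rintro ⟨q, rfl⟩
    have h3 : ((α - q * γ : ℚ) : ℝ) * x = ((q * δ - β : ℚ) : ℝ) := by
      push_cast
      rw [← h2] at h1
      linear_combination h1
    by_cases hc : α - q * γ = 0
    · rw [hc, Rat.cast_zero, zero_mul, eq_comm, Rat.cast_eq_zero] at h3
      apply hD
      have : ((α * δ - β * γ : ℤ) : ℚ) = 0 := by
        push_cast
        linear_combination (δ : ℚ) * hc + (γ : ℚ) * h3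
      exact_mod_cast this
    · refine hxi ⟨(q * δ - β) / (α - q * γ), ?_⟩
      rw [Rat.cast_div, ← h3]
      exact mul_div_cancel_left₀ _ (Rat.cast_ne_zero.2 hc)
  have hyI := cfInfinite_of_irrational hyi hy
  obtain ⟨K, hK, h⟩ := hx.exists_eventually_card_le hyI hD hρ h1 h2
  exact hyI.cfNormal_of_eventually_card_le hK h

theorem cfNormalReal.mobius {x : ℝ} (hx : cfNormalReal x) {M : Matrix (Fin 2) (Fin 2) ℤ}
    (hM : M.det ≠ 0) : cfNormalReal (mobius M x) := by
  rw [Matrix.det_fin_two] at hM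
  have hxi : Irrational (Int.fract x) := cfNormal.cfInfinite hx |>.irrational
  have hxi' : Irrational x := by
    rw [← Int.floor_add_fract x]
    exact hxi.intCast_add _
  have hρ : (M 1 0 : ℝ) * x + M 1 1 ≠ 0 := by
    intro h0
    by_cases hc : M 1 0 = 0
    · rw [hc, Int.cast_zero, zero_mul, zero_add, Int.cast_eq_zero] at h0
      exact hM (by rw [hc, h0]; ring)
    · refine hxi' ⟨-(M 1 1) / M 1 0, ?_⟩
      push_cast
      rw [div_eq_iff (by exact_mod_cast hc)]
      linarith
  set m := _root_.mobius M x with hm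
  have hmx : ((M 1 0 : ℝ) * x + M 1 1) * m = M 0 0 * x + M 0 1 := mul_div_cancel₀ _ hρ
  refine cfNormal.of_mobius_eq (α := M 0 0 - ⌊m⌋ * M 1 0)
    (β := M 0 0 * ⌊x⌋ + M 0 1 - ⌊m⌋ * (M 1 0 * ⌊x⌋ + M 1 1)) (γ := M 1 0)
    (δ := M 1 0 * ⌊x⌋ + M 1 1) hx ⟨Int.fract_nonneg _, Int.fract_lt_one _⟩ ?_ hρ ?_ ?_
  · intro h
    exact hM (by linear_combination h)
  · push_cast
    rw [Int.fract, Int.fract]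
    linear_combination -hmx
  · push_cast
    rw [Int.fract]
    ring

/-- Main theorem: any 2×2 integer matrix with nonzero determinant preserves
CF-normality; in particular `qx + r` is CF-normal for any rationals `q ≠ 0`, `r`
whenever `x` is CF-normal. -/
theorem cfNormal_mobius_action :
    (∀ (x : ℝ), cfNormalReal x →
      ∀ M : Matrix (Fin 2) (Fin 2) ℤ, M.det ≠ 0 → cfNormalReal (mobius M x)) ∧
    (∀ (x : ℝ), cfNormalReal x →
      ∀ q r : ℚ, q ≠ 0 → cfNormalReal ((q : ℝ) * x + (r : ℝ))) := by
  refine ⟨fun x hx M hM => hx.mobius hM, fun x hx q r hq => ?_⟩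
  have h := hx.mobius (M := !![q.num * r.den, r.num * q.den; 0, q.den * r.den]) (by
    rw [Matrix.det_fin_two_of]
    simp [hq])
  convert h using 1
  have hq' : (q.den : ℝ) ≠ 0 := by simp
  have hr' : (r.den : ℝ) ≠ 0 := by simp
  simp only [mobius, Matrix.of_apply, Matrix.cons_val_zero, Matrix.cons_val_one,
    Matrix.cons_val', Matrix.cons_val_fin_one]
  push_cast
  conv_lhs => rw [Rat.cast_def q, Rat.cast_def r]
  field_simp
  ring
end
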